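/- arXiv:1710.04401 — 2 statements merged into one kernel-verified Lean document; each statement's English description precedes it below -/
import Mathlib

section
/- Let K ∈ K_0^n with o ∈ int K and with boundary of class C^3_+, so that the L_{-n}-surface area measure of K satisfies dS_{K,-n} = f dH^{n-1} for a C^1 function f on S^{n-1}, where f(u) = h_K(u)^{n+1}/κ(u) and κ(u) is the Gaussian curvature of ∂K at the point with exterior normal u. If 𝒱(ξ) = ξ_j A^{ij} ∂_i is the projective vector field on S^{n-1} associated with a matrix A ∈ GL(n), then ∫_{S^{n-1}} h_K^{-n} 𝒱f dH^{n-1} = 0. -/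
open MeasureTheory Metric Set Filter
open scoped ENNReal RealInnerProductSpace NNReal

noncomputable section

abbrev Eu (n : ℕ) : Type := EuclideanSpace ℝ (Fin n)

def IsConvexBody {n : ℕ} (K : Set (Eu n)) : Prop :=
  Convex ℝ K ∧ IsCompact K ∧ (interior K).Nonempty

def suppFn {n : ℕ} (K : Set (Eu n)) (u : Eu n) : ℝ :=
  sSup ((fun x => ⟪x, u⟫) '' K)

def IsOuterNormal {n : ℕ} (K : Set (Eu n)) (x u : Eu n) : Prop :=
  ‖u‖ = 1 ∧ ∀ y ∈ K, ⟪y, u⟫ ≤ ⟪x, u⟫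

def gaussMap {n : ℕ} (K : Set (Eu n)) (x : Eu n) : Eu n :=
  open scoped Classical in
  if h : ∃ u, IsOuterNormal K x u then h.choose else 0

def lpSurf {n : ℕ} (p : ℝ) (K : Set (Eu n)) (ω : Set (Eu n)) : ℝ≥0∞ :=
  ∫⁻ x in {x ∈ frontier K | gaussMap K x ∈ ω},
    ENNReal.ofReal (⟪x, gaussMap K x⟫ ^ (1 - p)) ∂(μH[(n:ℝ) - 1])


section HausdorffComparison

theorem hausdorffMeasure_image_le_of_dist_le {X Y Z : Type*} [MetricSpace X] [MetricSpace Y]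
    [MeasurableSpace Y] [BorelSpace Y] [MetricSpace Z] [MeasurableSpace Z] [BorelSpace Z]
    {F : X → Y} {G : X → Z} {s : Set X} {k : ℝ≥0}
    (h : ∀ x ∈ s, ∀ y ∈ s, dist (F x) (F y) ≤ k * dist (G x) (G y)) {d : ℝ} (hd : 0 ≤ d) :
    μH[d] (F '' s) ≤ (k : ℝ≥0∞) ^ d * μH[d] (G '' s) := by
  rcases s.eq_empty_or_nonempty with rfl | ⟨x₀, hx₀⟩
  · simp
  have : Nonempty X := ⟨x₀⟩
  set φ : Z → Y := F ∘ Function.invFunOn G s with hφ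
  have hmem : ∀ z ∈ G '' s, Function.invFunOn G s z ∈ s ∧ G (Function.invFunOn G s z) = z :=
    fun z hz => ⟨Function.invFunOn_mem hz, Function.invFunOn_eq hz⟩
  have hlip : LipschitzOnWith k φ (G '' s) := by
    refine LipschitzOnWith.of_dist_le_mul fun z hz w hw => ?_
    have := h _ (hmem z hz).1 _ (hmem w hw).1
    rwa [(hmem z hz).2, (hmem w hw).2] at this
  have himg : φ '' (G '' s) = F '' s := by
    rw [image_image]
    refine image_congr fun x hx => ?_
    have hz := hmem (G x) (mem_image_of_mem G hx)
    have := h _ hz.1 _ hx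
    rw [hz.2, dist_self, mul_zero] at this
    exact dist_le_zero.1 this
  rw [← himg]
  exact hlip.hausdorffMeasure_image_le hd

theorem hausdorffMeasure_image_linearMap {W : Type*} [NormedAddCommGroup W]
    [InnerProductSpace ℝ W] [FiniteDimensional ℝ W] [MeasurableSpace W] [BorelSpace W]
    {d : ℝ} (hd : d = Module.finrank ℝ W) (T : W →ₗ[ℝ] W) (s : Set W) :
    μH[d] (T '' s) = ENNReal.ofReal |LinearMap.det T| * μH[d] s := by
  subst hd
  exact Measure.addHaar_image_linearMap _ T s

variable {E : Type*} [NormedAddCommGroup E] [InnerProductSpace ℝ E]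

theorem norm_sq_eq_norm_sq_proj_add (u : E) (hu : ‖u‖ = 1) (w : E) :
    ‖w‖ ^ 2 = ‖(ℝ ∙ u)ᗮ.orthogonalProjectionOnto w‖ ^ 2 + ⟪w, u⟫ ^ 2 := by
  have h := Submodule.norm_sq_eq_add_norm_sq_projection w (ℝ ∙ u)
  have h2 : ‖(ℝ ∙ u).orthogonalProjectionOnto w‖ = |⟪w, u⟫| := by
    rw [Submodule.coe_norm, ← Submodule.starProjection_apply,
      Submodule.starProjection_unit_singleton ℝ hu, norm_smul, hu, mul_one, real_inner_comm,
      Real.norm_eq_abs]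
  rw [h, h2, sq_abs, add_comm]

theorem norm_sub_le_of_mem_sphere_inter_ball {u : E} (hu : ‖u‖ = 1) {k : ℝ} (hk : 1 < k) :
    ∀ᶠ r in nhdsWithin (0 : ℝ) (Ioi 0), ∀ y ∈ sphere (0 : E) 1 ∩ ball u r,
      ∀ z ∈ sphere (0 : E) 1 ∩ ball u r,
        ‖y - z‖ ≤ k * ‖(ℝ ∙ u)ᗮ.orthogonalProjectionOnto (y - z)‖ := by
  have hlim : ∀ᶠ r : ℝ in nhds 0, 1 ≤ k ^ 2 * (1 - r ^ 2) := by
    have : Tendsto (fun r : ℝ => k ^ 2 * (1 - r ^ 2)) (nhds 0) (nhds (k ^ 2 * (1 - 0 ^ 2))) :=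
      Continuous.tendsto (by fun_prop) 0
    filter_upwards [this.eventually (lt_mem_nhds (a := 1) (by nlinarith))] with r hr using hr.le
  filter_upwards [nhdsWithin_le_nhds hlim, self_mem_nhdsWithin] with r hr hr0 y hy z hz
  have hr0 : 0 < r := hr0
  have hyn : ‖y‖ = 1 := by simpa using hy.1
  have hzn : ‖z‖ = 1 := by simpa using hz.1
  have hyu : ‖u - y‖ < r := by simpa [dist_eq_norm, norm_sub_rev] using hy.2
  have hzu : ‖u - z‖ < r := by simpa [dist_eq_norm, norm_sub_rev] using hz.2
  have horth : ⟪y - z, y + z⟫ = 0 := by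
    rw [inner_sub_left, inner_add_right, inner_add_right, real_inner_self_eq_norm_sq,
      real_inner_self_eq_norm_sq, hyn, hzn, real_inner_comm]; ring
  have h2 : 2 * ⟪y - z, u⟫ = ⟪y - z, u - y⟫ + ⟪y - z, u - z⟫ := by
    rw [inner_sub_right (y - z), inner_sub_right (y - z)]
    rw [inner_add_right] at horth
    linarith
  have h3 : |⟪y - z, u⟫| ≤ r * ‖y - z‖ := by
    have a := abs_real_inner_le_norm (y - z) (u - y)
    have b := abs_real_inner_le_norm (y - z) (u - z)
    have c : |2 * ⟪y - z, u⟫| ≤ 2 * (r * ‖y - z‖) := by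
      rw [h2]
      refine (abs_add_le _ _).trans ?_
      nlinarith [norm_nonneg (y - z)]
    rw [abs_mul, abs_two] at c
    linarith
  have h4 : ⟪y - z, u⟫ ^ 2 ≤ r ^ 2 * ‖y - z‖ ^ 2 := by
    rw [← mul_pow, ← sq_abs]
    exact pow_le_pow_left₀ (abs_nonneg _) h3 2
  have h5 := norm_sq_eq_norm_sq_proj_add u hu (y - z)
  refine abs_le_of_sq_le_sq' ?_ (by positivity) |>.2
  rw [mul_pow]
  nlinarith [sq_nonneg ‖y - z‖, sq_nonneg k]

end HausdorffComparison

section SphereMeasure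

set_option linter.unusedSectionVars false

variable {E : Type*} [NormedAddCommGroup E] [InnerProductSpace ℝ E] [FiniteDimensional ℝ E]
  [MeasurableSpace E] [BorelSpace E]

theorem finrank_orthogonal_singleton_eq {d : ℝ} (hd : d + 1 = Module.finrank ℝ E) {u : E}
    (hu : ‖u‖ = 1) : d = Module.finrank ℝ (ℝ ∙ u)ᗮ := by
  have h := Submodule.finrank_add_finrank_orthogonal (ℝ ∙ u)
  rw [finrank_span_singleton (by rintro rfl; simp at hu)] at h
  rw [← h] at hd
  push_cast at hd
  linarith

theorem hausdorffMeasure_sphere_inter_ball_le {d : ℝ} (hd : 0 ≤ d) {u : E} (hu : ‖u‖ = 1)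
    {k : ℝ≥0} (hk : 1 < k) :
    ∀ᶠ r in nhdsWithin (0 : ℝ) (Ioi 0), μH[d] (sphere (0 : E) 1 ∩ ball u r) ≤
      (k : ℝ≥0∞) ^ d *
        μH[d] ((ℝ ∙ u)ᗮ.orthogonalProjectionOnto '' (sphere (0 : E) 1 ∩ ball u r)) := by
  filter_upwards [norm_sub_le_of_mem_sphere_inter_ball hu (k := k) (by exact_mod_cast hk)]
    with r hr
  have := hausdorffMeasure_image_le_of_dist_le (F := id)
    (G := (ℝ ∙ u)ᗮ.orthogonalProjectionOnto) (s := sphere (0 : E) 1 ∩ ball u r) (k := k)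
    (fun y hy z hz => by
      rw [id, id, dist_eq_norm, dist_eq_norm, ← map_sub]; exact hr y hy z hz) hd
  rwa [image_id] at this

theorem hausdorffMeasure_sphere_lt_top {d : ℝ} (hd0 : 0 ≤ d)
    (hd : d + 1 = Module.finrank ℝ E) : μH[d] (sphere (0 : E) 1) < ∞ := by
  refine (isCompact_sphere (0 : E) 1).measure_lt_top_of_nhdsWithin fun u hu => ?_
  have hu : ‖u‖ = 1 := by simpa using hu
  obtain ⟨r, hr, hr0⟩ := ((hausdorffMeasure_sphere_inter_ball_le hd0 hu (k := 2)
    (by norm_num)).and self_mem_nhdsWithin).exists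
  refine ⟨sphere (0 : E) 1 ∩ ball u r,
    inter_mem self_mem_nhdsWithin (mem_nhdsWithin_of_mem_nhds (ball_mem_nhds u hr0)), ?_⟩
  refine hr.trans_lt (ENNReal.mul_lt_top (ENNReal.rpow_lt_top_of_nonneg hd0 (by simp)) ?_)
  rw [finrank_orthogonal_singleton_eq hd hu]
  have hb : Bornology.IsBounded
      ((ℝ ∙ u)ᗮ.orthogonalProjectionOnto '' (sphere (0 : E) 1 ∩ ball u r)) :=
    (ℝ ∙ u)ᗮ.lipschitzWith_orthogonalProjectionOnto.isBounded_image
      (isBounded_sphere.subset inter_subset_left)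
  exact hb.measure_lt_top

theorem hausdorffMeasure_sphere_inter_ball_pos {d : ℝ} (hd0 : 0 ≤ d)
    (hd : d + 1 = Module.finrank ℝ E) {u : E} (hu : ‖u‖ = 1) {r : ℝ} (hr : 0 < r) :
    0 < μH[d] (sphere (0 : E) 1 ∩ ball u r) := by
  set P := (ℝ ∙ u)ᗮ.orthogonalProjectionOnto with hP
  have h1 : μH[d] (P '' (sphere (0 : E) 1 ∩ ball u r)) ≤ μH[d] (sphere (0 : E) 1 ∩ ball u r) := by
    simpa using (ℝ ∙ u)ᗮ.lipschitzWith_orthogonalProjectionOnto.hausdorffMeasure_image_le hd0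
      (sphere (0 : E) 1 ∩ ball u r)
  refine lt_of_lt_of_le ?_ h1
  have hsub : ball (0 : (ℝ ∙ u)ᗮ) (min 1 (r / 2)) ⊆ P '' (sphere (0 : E) 1 ∩ ball u r) := by
    intro v hv
    have hv' : ‖v‖ < min 1 (r / 2) := by simpa using hv
    have hv1 : ‖v‖ < 1 := hv'.trans_le (min_le_left _ _)
    have hv2 : ‖v‖ < r / 2 := hv'.trans_le (min_le_right _ _)
    have hvu : ⟪(v : E), u⟫ = 0 := Submodule.mem_orthogonal_singleton_iff_inner_left.1 v.2
    set s := √(1 - ‖v‖ ^ 2) with hs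
    have hv0 := norm_nonneg v
    have hs2 : s ^ 2 = 1 - ‖v‖ ^ 2 := Real.sq_sqrt (by nlinarith)
    have hs0 : 0 ≤ s := Real.sqrt_nonneg _
    have hs1 : s ≤ 1 := by nlinarith
    refine ⟨v + s • u, ⟨?_, ?_⟩, ?_⟩
    · have : ‖(v : E) + s • u‖ ^ 2 = 1 := by
        rw [norm_add_sq_real, inner_smul_right, hvu, norm_smul, hu, mul_one, Real.norm_eq_abs,
          sq_abs, hs2, Submodule.coe_norm]
        ring
      have h0 := norm_nonneg ((v : E) + s • u)
      rw [mem_sphere_zero_iff_norm]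
      nlinarith
    · have : (v : E) + s • u - u = v + (s - 1) • u := by rw [sub_smul, one_smul]; abel
      rw [mem_ball, dist_eq_norm, this]
      refine (norm_add_le _ _).trans_lt ?_
      rw [norm_smul, hu, mul_one, Real.norm_eq_abs, abs_of_nonpos (by linarith),
        ← Submodule.coe_norm]
      nlinarith
    · have hPu : P u = 0 :=
        Submodule.orthogonalProjectionOnto_orthogonal_apply_eq_zero
          (Submodule.mem_span_singleton_self u)
      rw [map_add, map_smul, hPu, smul_zero, add_zero]
      exact Submodule.orthogonalProjectionOnto_mem_subspace_eq_self v
  refine lt_of_lt_of_le ?_ (measure_mono hsub)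
  rw [finrank_orthogonal_singleton_eq hd hu]
  exact measure_ball_pos _ _ (lt_min one_pos (half_pos hr))

theorem exists_linearIsometryEquiv_eq {u v : E} (h : ‖u‖ = ‖v‖) :
    ∃ g : E ≃ₗᵢ[ℝ] E, g u = v :=
  ⟨_, Submodule.reflection_sub h⟩

theorem image_sphere_inter_closedBall (g : E ≃ₗᵢ[ℝ] E) (u : E) (r : ℝ) :
    g '' (sphere (0 : E) 1 ∩ closedBall u r) = sphere (0 : E) 1 ∩ closedBall (g u) r := by
  rw [image_inter g.injective, g.image_sphere, g.image_closedBall, map_zero]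

open scoped Pointwise in
theorem toSphere_map_closedBall (g : E ≃ₗᵢ[ℝ] E) (u : E) (r : ℝ) :
    (volume : Measure E).toSphere.map Subtype.val (closedBall (g u) r) =
      (volume : Measure E).toSphere.map Subtype.val (closedBall u r) := by
  have key : ∀ w : E, (volume : Measure E).toSphere.map Subtype.val (closedBall w r) =
      Module.finrank ℝ E *
        volume (Ioo (0 : ℝ) 1 • (sphere (0 : E) 1 ∩ closedBall w r)) := by
    intro w
    rw [Measure.map_apply measurable_subtype_coe measurableSet_closedBall,
      Measure.toSphere_apply' _ (measurable_subtype_coe measurableSet_closedBall),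
      Subtype.image_preimage_coe]
  rw [key, key, ← image_sphere_inter_closedBall]
  have : Ioo (0 : ℝ) 1 • (g '' (sphere (0 : E) 1 ∩ closedBall u r)) =
      g '' (Ioo (0 : ℝ) 1 • (sphere (0 : E) 1 ∩ closedBall u r)) := by
    ext x
    simp only [Set.mem_smul, mem_image]
    constructor
    · rintro ⟨t, ht, _, ⟨y, hy, rfl⟩, rfl⟩
      exact ⟨t • y, ⟨t, ht, y, hy, rfl⟩, map_smul g t y⟩
    · rintro ⟨_, ⟨t, ht, y, hy, rfl⟩, rfl⟩
      exact ⟨t, ht, _, ⟨y, hy, rfl⟩, (map_smul g t y).symm⟩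
  rw [this, ← g.coe_toMeasurableEquiv, MeasurableEquiv.image_eq_preimage_symm]
  congr 1
  exact g.symm.measurePreserving.measure_preimage_emb
    g.symm.toMeasurableEquiv.measurableEmbedding _

theorem integral_hausdorffMeasure_sphere_eq_zero [Nontrivial E] {d : ℝ} (hd0 : 0 ≤ d)
    (hd : d + 1 = Module.finrank ℝ E) {q : E → ℝ}
    (hqi : Integrable (fun u : sphere (0 : E) 1 => q u) (volume : Measure E).toSphere)
    (hq : ∫ u : sphere (0 : E) 1, q u ∂(volume : Measure E).toSphere = 0) :
    ∫ u in sphere (0 : E) 1, q u ∂μH[d] = 0 := by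
  set σ : Measure E := μH[d].restrict (sphere (0 : E) 1) with hσ
  set τ : Measure E := (volume : Measure E).toSphere.map Subtype.val with hτ
  have hemb : MeasurableEmbedding (Subtype.val : sphere (0 : E) 1 → E) :=
    MeasurableEmbedding.subtype_coe isClosed_sphere.measurableSet
  have : IsFiniteMeasure σ := ⟨by
    rw [hσ, Measure.restrict_apply_univ]; exact hausdorffMeasure_sphere_lt_top hd0 hd⟩
  have : IsFiniteMeasure τ := Measure.isFiniteMeasure_map _ _
  have hiτ : Integrable q τ := by rw [hτ, hemb.integrable_map_iff]; exact hqi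
  have hqτ : ∫ u, q u ∂τ = 0 := by rw [hτ, hemb.integral_map]; exact hq
  have hτ0 : τ ≠ 0 := by
    rw [hτ, Ne, Measure.map_eq_zero_iff measurable_subtype_coe.aemeasurable]
    exact Measure.toSphere_ne_zero _
  have hστ0 : σ + τ ≠ 0 := fun h => hτ0 <| by
    rw [← Measure.measure_univ_eq_zero] at h ⊢
    exact (add_eq_zero.1 h).2
  have hS : ∀ᵐ x ∂(σ + τ), x ∈ sphere (0 : E) 1 := by
    rw [ae_add_measure_iff]
    refine ⟨ae_restrict_mem isClosed_sphere.measurableSet, ?_⟩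
    rw [hτ, hemb.ae_map_iff]
    exact Eventually.of_forall fun x => x.2
  have hinv : ∀ u ∈ sphere (0 : E) 1, ∀ v ∈ sphere (0 : E) 1, ∀ r,
      τ (closedBall u r) / (σ + τ) (closedBall u r) =
        τ (closedBall v r) / (σ + τ) (closedBall v r) := by
    intro u hu v hv r
    obtain ⟨g, rfl⟩ := exists_linearIsometryEquiv_eq (u := u) (v := v)
      (by rw [mem_sphere_zero_iff_norm.1 hu, mem_sphere_zero_iff_norm.1 hv])
    have h1 := toSphere_map_closedBall g u r
    have h2 : σ (closedBall (g u) r) = σ (closedBall u r) := by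
      rw [hσ, Measure.restrict_apply measurableSet_closedBall,
        Measure.restrict_apply measurableSet_closedBall, inter_comm, inter_comm (closedBall u r),
        ← image_sphere_inter_closedBall, g.isometry.hausdorffMeasure_image (Or.inl hd0)]
    simp only [Measure.add_apply, ← hτ] at h1 ⊢
    rw [h1, h2]
  obtain ⟨c, hc⟩ : ∃ c : ℝ≥0∞, τ.rnDeriv (σ + τ) =ᵐ[σ + τ] fun _ => c := by
    have hne : (ae (σ + τ)).NeBot := by
      rwa [ae_neBot]
    have hall := (Besicovitch.ae_tendsto_rnDeriv τ (σ + τ)).and hS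
    obtain ⟨u, hu, huS⟩ := hall.exists
    refine ⟨τ.rnDeriv (σ + τ) u, ?_⟩
    filter_upwards [hall] with v hv
    refine tendsto_nhds_unique hv.1 (hu.congr fun r => hinv u huS v hv.2 r)
  have habs : τ ≪ σ + τ := (Measure.le_add_left le_rfl).absolutelyContinuous
  have hτc : τ = c • (σ + τ) := by
    conv_lhs => rw [← Measure.withDensity_rnDeriv_eq τ (σ + τ) habs]
    rw [withDensity_congr_ae hc, withDensity_const]
  have hc0 : c ≠ 0 := by
    rintro rfl
    exact hτ0 (by simpa using hτc)
  have hctop : c ≠ ∞ := by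
    rintro rfl
    have h1 : τ univ = ∞ * (σ + τ) univ := by
      conv_lhs => rw [hτc]
      rfl
    rw [ENNReal.top_mul] at h1
    · exact measure_ne_top τ univ h1
    · rwa [Ne, Measure.measure_univ_eq_zero]
  by_cases hi : Integrable q σ
  · have h1 : ∫ u, q u ∂τ = c.toReal * (∫ u, q u ∂σ + ∫ u, q u ∂τ) := by
      conv_lhs => rw [hτc]
      rw [integral_smul_measure, integral_add_measure hi hiτ, smul_eq_mul]
    rw [hqτ, add_zero] at h1
    exact (mul_eq_zero.1 h1.symm).resolve_left (ENNReal.toReal_ne_zero.2 ⟨hc0, hctop⟩)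
  · exact integral_undef hi

end SphereMeasure

section SupportFunction

variable {n : ℕ} {K : Set (Eu n)}

theorem bddAbove_inner_image (hK : IsConvexBody K) (u : Eu n) :
    BddAbove ((fun x => ⟪x, u⟫) '' K) :=
  (hK.2.1.image (by fun_prop)).bddAbove

theorem inner_le_suppFn (hK : IsConvexBody K) {x : Eu n} (hx : x ∈ K) (u : Eu n) :
    ⟪x, u⟫ ≤ suppFn K u :=
  le_csSup (bddAbove_inner_image hK u) (mem_image_of_mem _ hx)

theorem exists_inner_eq_suppFn (hK : IsConvexBody K) (u : Eu n) :
    ∃ x ∈ K, ⟪x, u⟫ = suppFn K u := by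
  have hne : K.Nonempty := hK.2.2.mono interior_subset
  obtain ⟨x, hx, hmax⟩ := hK.2.1.exists_isMaxOn hne
    (f := fun x => ⟪x, u⟫) (by fun_prop)
  refine ⟨x, hx, le_antisymm (inner_le_suppFn hK hx u) ?_⟩
  refine csSup_le (hne.image _) ?_
  rintro _ ⟨y, hy, rfl⟩
  exact hmax hy

theorem suppFn_smul (hK : IsConvexBody K) {c : ℝ} (hc : 0 ≤ c) (u : Eu n) :
    suppFn K (c • u) = c * suppFn K u := by
  obtain ⟨x, hx, hxu⟩ := exists_inner_eq_suppFn hK u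
  obtain ⟨y, hy, hyu⟩ := exists_inner_eq_suppFn hK (c • u)
  apply le_antisymm
  · rw [← hyu, inner_smul_right]
    exact mul_le_mul_of_nonneg_left (inner_le_suppFn hK hy u) hc
  · rw [← hxu, ← inner_smul_right]
    exact inner_le_suppFn hK hx _

theorem exists_mul_norm_le_suppFn (hK : IsConvexBody K) (h0 : (0 : Eu n) ∈ interior K) :
    ∃ r > 0, ∀ u, r * ‖u‖ ≤ suppFn K u := by
  obtain ⟨r, hr, hrK⟩ := Metric.nhds_basis_closedBall.mem_iff.1 (mem_interior_iff_mem_nhds.1 h0)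
  refine ⟨r, hr, fun u => ?_⟩
  rcases eq_or_ne u 0 with rfl | hu
  · have := inner_le_suppFn hK (interior_subset h0) (0 : Eu n)
    simpa using this
  have hu' : ‖u‖ ≠ 0 := norm_ne_zero_iff.2 hu
  have hmem : (r / ‖u‖) • u ∈ K := hrK (by
    rw [mem_closedBall_zero_iff, norm_smul, Real.norm_eq_abs,
      abs_of_nonneg (by positivity), div_mul_cancel₀ _ hu'])
  have := inner_le_suppFn hK hmem u
  rwa [real_inner_smul_left, real_inner_self_eq_norm_sq, div_mul_eq_mul_div, pow_two,
    ← mul_assoc, mul_div_assoc, div_self hu', mul_one] at this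

theorem suppFn_pos (hK : IsConvexBody K) (h0 : (0 : Eu n) ∈ interior K) {u : Eu n}
    (hu : u ≠ 0) : 0 < suppFn K u := by
  obtain ⟨r, hr, h⟩ := exists_mul_norm_le_suppFn hK h0
  exact (mul_pos hr (norm_pos_iff.2 hu)).trans_le (h u)

theorem exists_lipschitzWith_suppFn (hK : IsConvexBody K) : ∃ C, LipschitzWith C (suppFn K) := by
  obtain ⟨R, hR⟩ := hK.2.1.isBounded.exists_norm_le
  refine ⟨R.toNNReal, LipschitzWith.of_le_add_mul' R fun u v => ?_⟩
  obtain ⟨x, hx, hxu⟩ := exists_inner_eq_suppFn hK u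
  have h1 := inner_le_suppFn hK hx v
  have h2 : ⟪x, u - v⟫ ≤ R * dist u v := by
    rw [dist_eq_norm]
    exact (real_inner_le_norm _ _).trans (mul_le_mul_of_nonneg_right (hR x hx) (norm_nonneg _))
  rw [inner_sub_right] at h2
  linarith

theorem gradient_suppFn_eq_of_forall_inner_le {u x : Eu n}
    (hd : DifferentiableAt ℝ (suppFn K) u) (hx : ∀ v, ⟪x, v⟫ ≤ suppFn K v)
    (hxu : ⟪x, u⟫ = suppFn K u) : gradient (suppFn K) u = x := by
  have hmin : IsLocalMin (fun v => suppFn K v - ⟪x, v⟫) u :=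
    Eventually.of_forall fun v => by
      have := hx v
      simp only [hxu, sub_self]
      linarith
  have hder : HasFDerivAt (fun v => suppFn K v - ⟪x, v⟫)
      (fderiv ℝ (suppFn K) u - innerSL ℝ x) u :=
    hd.hasFDerivAt.sub (innerSL ℝ x).hasFDerivAt
  have h0 := hmin.hasFDerivAt_eq_zero hder
  refine ext_inner_right ℝ fun w => ?_
  rw [inner_gradient_left, sub_eq_zero.1 h0, innerSL_apply_apply]

theorem gradient_suppFn_eq (hK : IsConvexBody K) {u x : Eu n}
    (hd : DifferentiableAt ℝ (suppFn K) u) (hx : x ∈ K) (hxu : ⟪x, u⟫ = suppFn K u) :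
    gradient (suppFn K) u = x :=
  gradient_suppFn_eq_of_forall_inner_le hd (inner_le_suppFn hK hx) hxu

section Differentiable

variable (hK : IsConvexBody K) (hd : ∀ u : Eu n, u ≠ 0 → DifferentiableAt ℝ (suppFn K) u)
include hK hd

theorem gradient_suppFn_mem {u : Eu n} (hu : u ≠ 0) : gradient (suppFn K) u ∈ K := by
  obtain ⟨x, hx, hxu⟩ := exists_inner_eq_suppFn hK u
  rwa [gradient_suppFn_eq hK (hd u hu) hx hxu]

theorem inner_gradient_suppFn_self {u : Eu n} (hu : u ≠ 0) :
    ⟪gradient (suppFn K) u, u⟫ = suppFn K u := by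
  obtain ⟨x, hx, hxu⟩ := exists_inner_eq_suppFn hK u
  rwa [gradient_suppFn_eq hK (hd u hu) hx hxu]

theorem gradient_suppFn_smul {u : Eu n} (hu : u ≠ 0) {c : ℝ} (hc : 0 < c) :
    gradient (suppFn K) (c • u) = gradient (suppFn K) u := by
  refine gradient_suppFn_eq hK (hd _ (smul_ne_zero hc.ne' hu)) (gradient_suppFn_mem hK hd hu) ?_
  rw [inner_smul_right, inner_gradient_suppFn_self hK hd hu, suppFn_smul hK hc.le]

theorem inner_gradient_suppFn_sub_nonneg {u v : Eu n} (hu : u ≠ 0) (hv : v ≠ 0) :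
    0 ≤ ⟪gradient (suppFn K) u - gradient (suppFn K) v, u - v⟫ := by
  have h1 := inner_le_suppFn hK (gradient_suppFn_mem hK hd hu) v
  have h2 := inner_le_suppFn hK (gradient_suppFn_mem hK hd hv) u
  have h3 := inner_gradient_suppFn_self hK hd hu
  have h4 := inner_gradient_suppFn_self hK hd hv
  rw [inner_sub_left, inner_sub_right, inner_sub_right]
  linarith

end Differentiable

section Smooth

theorem differentiableAt_suppFn (hh : ContDiffOn ℝ 3 (suppFn K) {(0 : Eu n)}ᶜ) {u : Eu n}
    (hu : u ≠ 0) : DifferentiableAt ℝ (suppFn K) u :=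
  (hh.differentiableOn (by norm_num)).differentiableAt (isOpen_compl_singleton.mem_nhds hu)

theorem contDiffOn_gradient_suppFn (hh : ContDiffOn ℝ 3 (suppFn K) {(0 : Eu n)}ᶜ) :
    ContDiffOn ℝ 1 (gradient (suppFn K)) {(0 : Eu n)}ᶜ :=
  (InnerProductSpace.toDual ℝ (Eu n)).symm.contDiff.comp_contDiffOn
    (hh.fderiv_of_isOpen isOpen_compl_singleton (by norm_num))

theorem contDiffAt_gradient_suppFn (hh : ContDiffOn ℝ 3 (suppFn K) {(0 : Eu n)}ᶜ) {u : Eu n}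
    (hu : u ≠ 0) : ContDiffAt ℝ 1 (gradient (suppFn K)) u :=
  (contDiffOn_gradient_suppFn hh).contDiffAt (isOpen_compl_singleton.mem_nhds hu)

variable (hK : IsConvexBody K) (hh : ContDiffOn ℝ 3 (suppFn K) {(0 : Eu n)}ᶜ)
include hK hh

theorem fderiv_gradient_suppFn_self {u : Eu n} (hu : u ≠ 0) :
    fderiv ℝ (gradient (suppFn K)) u u = 0 := by
  have hd : HasFDerivAt (gradient (suppFn K)) (fderiv ℝ (gradient (suppFn K)) u)
      ((1 : ℝ) • u) := by
    rw [one_smul]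
    exact ((contDiffAt_gradient_suppFn hh hu).differentiableAt (by norm_num)).hasFDerivAt
  have h1 := hd.comp_hasDerivAt (1 : ℝ) ((hasDerivAt_id (1 : ℝ)).smul_const u)
  have h2 : HasDerivAt (gradient (suppFn K) ∘ fun t : ℝ => id t • u) 0 1 := by
    refine (hasDerivAt_const (1 : ℝ) (gradient (suppFn K) u)).congr_of_eventuallyEq ?_
    filter_upwards [lt_mem_nhds (zero_lt_one' ℝ)] with t ht
    exact gradient_suppFn_smul hK (fun u hu => differentiableAt_suppFn hh hu) hu ht
  simpa using h1.unique h2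

theorem inner_fderiv_gradient_suppFn {u : Eu n} (hu : u ≠ 0) (w : Eu n) :
    ⟪fderiv ℝ (gradient (suppFn K)) u w, u⟫ = 0 := by
  have hd : HasFDerivAt (gradient (suppFn K)) (fderiv ℝ (gradient (suppFn K)) u) u :=
    ((contDiffAt_gradient_suppFn hh hu).differentiableAt (by norm_num)).hasFDerivAt
  have h1 := hd.inner ℝ (hasFDerivAt_id u)
  have h2 : HasFDerivAt (fun v => ⟪gradient (suppFn K) v, id v⟫) (fderiv ℝ (suppFn K) u) u := by
    refine (differentiableAt_suppFn hh hu).hasFDerivAt.congr_of_eventuallyEq ?_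
    filter_upwards [isOpen_ne.mem_nhds hu] with v hv
    exact inner_gradient_suppFn_self hK (fun u hu => differentiableAt_suppFn hh hu) hv
  have h3 := congrArg (fun L => L w) (h1.unique h2)
  simp only [← inner_gradient_left (f := suppFn K)] at h3
  simpa using h3

theorem inner_fderiv_gradient_suppFn_nonneg {u : Eu n} (hu : u ≠ 0) (w : Eu n) :
    0 ≤ ⟪fderiv ℝ (gradient (suppFn K)) u w, w⟫ := by
  have hd : HasFDerivAt (gradient (suppFn K)) (fderiv ℝ (gradient (suppFn K)) u) u :=
    ((contDiffAt_gradient_suppFn hh hu).differentiableAt (by norm_num)).hasFDerivAt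
  have h1 := hd.hasLineDerivAt w
  have h2 : HasDerivAt (fun t : ℝ => ⟪gradient (suppFn K) (u + t • w), w⟫)
      ⟪fderiv ℝ (gradient (suppFn K)) u w, w⟫ 0 := by
    simpa using HasDerivAt.inner ℝ h1 (hasDerivAt_const (0 : ℝ) w)
  have hlim := h2.tendsto_slope_zero_right
  refine ge_of_tendsto hlim ?_
  have hne : ∀ᶠ t : ℝ in nhds 0, u + t • w ≠ 0 :=
    (Continuous.tendsto' (by fun_prop) 0 u (by simp)).eventually (isOpen_ne.mem_nhds hu)
  filter_upwards [nhdsWithin_le_nhds hne, self_mem_nhdsWithin] with t ht ht0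
  have ht0 : 0 < t := ht0
  have := inner_gradient_suppFn_sub_nonneg hK (fun u hu => differentiableAt_suppFn hh hu) ht hu
  rw [add_sub_cancel_left, inner_smul_right, inner_sub_left] at this
  simp only [zero_add, zero_smul, add_zero, smul_eq_mul]
  exact mul_nonneg (inv_nonneg.2 ht0.le) ((mul_nonneg_iff_of_pos_left ht0).1 this)

end Smooth

end SupportFunction

section Determinant

variable {E : Type*} [NormedAddCommGroup E] [InnerProductSpace ℝ E]

/-- The compression of a linear map to the orthogonal complement of `u`. -/
def tangentCompression (u : E) (L : E →ₗ[ℝ] E) : (ℝ ∙ u)ᗮ →ₗ[ℝ] (ℝ ∙ u)ᗮ :=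
  (ℝ ∙ u)ᗮ.orthogonalProjectionOnto.toLinearMap ∘ₗ L ∘ₗ (ℝ ∙ u)ᗮ.subtype

theorem inner_coe_orthogonal (u : E) (v : (ℝ ∙ u)ᗮ) : ⟪u, (v : E)⟫ = 0 :=
  Submodule.mem_orthogonal_singleton_iff_inner_right.1 v.2

theorem orthogonalProjectionOnto_singleton_orthogonal_self (u : E) :
    (ℝ ∙ u)ᗮ.orthogonalProjectionOnto u = 0 :=
  Submodule.orthogonalProjectionOnto_orthogonal_apply_eq_zero
    (Submodule.mem_span_singleton_self u)

theorem inner_smul_add_orthogonalProjectionOnto {u : E} (hu : ‖u‖ = 1) (x : E) :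
    ⟪u, x⟫ • u + ((ℝ ∙ u)ᗮ.orthogonalProjectionOnto x : E) = x := by
  rw [← Submodule.starProjection_apply, ← Submodule.starProjection_unit_singleton ℝ hu]
  exact Submodule.starProjection_add_starProjection_orthogonal x

theorem coe_tangentCompression_proj {u : E} (hu : ‖u‖ = 1) {L : E →ₗ[ℝ] E} (hL : L u = 0)
    (hL' : ∀ w, ⟪L w, u⟫ = 0) (w : E) :
    (tangentCompression u L ((ℝ ∙ u)ᗮ.orthogonalProjectionOnto w) : E) = L w := by
  have h1 : L w = L ((ℝ ∙ u)ᗮ.orthogonalProjectionOnto w : E) := by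
    conv_lhs => rw [← inner_smul_add_orthogonalProjectionOnto hu w]
    rw [map_add, map_smul, hL, smul_zero, zero_add]
  have h2 := inner_smul_add_orthogonalProjectionOnto hu (L w)
  rw [real_inner_comm, hL', zero_smul, zero_add] at h2
  rw [tangentCompression]
  simp only [LinearMap.comp_apply, Submodule.subtype_apply]
  rw [← h1]
  exact h2

/-- The orthogonal splitting of a space along a unit vector. -/
def splitAlong (u : E) (hu : ‖u‖ = 1) : (ℝ × (ℝ ∙ u)ᗮ) ≃ₗ[ℝ] E :=
  LinearEquiv.ofLinearMap
    ((LinearMap.toSpanSingleton ℝ E u).coprod (ℝ ∙ u)ᗮ.subtype)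
    ((innerₛₗ ℝ u).prod (ℝ ∙ u)ᗮ.orthogonalProjectionOnto.toLinearMap)
    (by
      ext x
      simpa using inner_smul_add_orthogonalProjectionOnto hu x)
    (by
      ext x
      · simp [hu]
      · simp [orthogonalProjectionOnto_singleton_orthogonal_self]
      · simp [inner_coe_orthogonal]
      · simp)

theorem splitAlong_apply (u : E) (hu : ‖u‖ = 1) (p : ℝ × (ℝ ∙ u)ᗮ) :
    splitAlong u hu p = p.1 • u + (p.2 : E) := rfl

variable [FiniteDimensional ℝ E]

theorem det_smul_add_inner_smul {u : E} (hu : ‖u‖ = 1) {L : E →ₗ[ℝ] E} (hL : L u = 0)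
    (hL' : ∀ w, ⟪L w, u⟫ = 0) (x : E) (hx : ⟪x, u⟫ ≠ 0) :
    LinearMap.det (⟪x, u⟫ • L + (innerₛₗ ℝ x).smulRight x) =
      ⟪x, u⟫ ^ (Module.finrank ℝ E + 1) * LinearMap.det (tangentCompression u L) := by
  set a := ⟪x, u⟫ with ha
  set p := x - a • u with hp
  have hpu : ⟪u, p⟫ = 0 := by
    rw [hp, inner_sub_right, inner_smul_right, real_inner_self_eq_norm_sq, hu, real_inner_comm,
      ← ha]
    ring
  set D : E →ₗ[ℝ] E := a • L + (a ^ 2) • (innerₛₗ ℝ u).smulRight u with hD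
  set R₁ : E →ₗ[ℝ] E := LinearMap.transvection (a⁻¹ • innerₛₗ ℝ u) p with hR₁
  set R₂ : E →ₗ[ℝ] E := LinearMap.transvection (a⁻¹ • innerₛₗ ℝ p) u with hR₂
  have hfac : a • L + (innerₛₗ ℝ x).smulRight x = R₁ ∘ₗ D ∘ₗ R₂ := by
    ext1 w
    have hxw : ⟪x, w⟫ = ⟪p, w⟫ + a * ⟪u, w⟫ := by
      rw [hp, inner_sub_left, real_inner_smul_left]; ring
    have hxp : x = p + a • u := by rw [hp]; abel
    have h1 : D (R₂ w) = a • L w + (a ^ 2 * ⟪u, w⟫ + a * ⟪p, w⟫) • u := by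
      simp only [hR₂, LinearMap.transvection.apply, LinearMap.smul_apply, innerₛₗ_apply_apply,
        hD, LinearMap.add_apply, LinearMap.smulRight_apply, map_add, map_smul, hL,
        real_inner_self_eq_norm_sq, hu, smul_eq_mul]
      match_scalars <;> field_simp
    have h2 : ⟪u, D (R₂ w)⟫ = a ^ 2 * ⟪u, w⟫ + a * ⟪p, w⟫ := by
      rw [h1, inner_add_right, inner_smul_right, inner_smul_right, real_inner_comm, hL',
        real_inner_self_eq_norm_sq, hu]
      ring
    rw [LinearMap.comp_apply, LinearMap.comp_apply, hR₁, LinearMap.transvection.apply,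
      LinearMap.smul_apply, innerₛₗ_apply_apply, h2, h1, LinearMap.add_apply,
      LinearMap.smul_apply, LinearMap.smulRight_apply, innerₛₗ_apply_apply, hxw]
    rw [hxp]
    have : a⁻¹ • (a ^ 2 * ⟪u, w⟫ + a * ⟪p, w⟫) = a * ⟪u, w⟫ + ⟪p, w⟫ := by
      rw [smul_eq_mul]; field_simp
    rw [this]
    module
  have hdet₁ : LinearMap.det R₁ = 1 := by
    rw [hR₁, LinearMap.transvection.det]; simp [hpu]
  have hdet₂ : LinearMap.det R₂ = 1 := by
    rw [hR₂, LinearMap.transvection.det]; simp [real_inner_comm, hpu]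
  have hconj : D ∘ₗ (splitAlong u hu).toLinearMap = (splitAlong u hu).toLinearMap ∘ₗ
      LinearMap.prodMap ((a ^ 2) • LinearMap.id) (a • tangentCompression u L) := by
    refine LinearMap.ext fun q => ?_
    have h1 := coe_tangentCompression_proj hu hL hL' (q.2 : E)
    rw [Submodule.orthogonalProjectionOnto_mem_subspace_eq_self] at h1
    simp only [LinearMap.comp_apply, LinearEquiv.coe_coe, splitAlong_apply, hD,
      LinearMap.prodMap_apply, LinearMap.add_apply, LinearMap.smul_apply, LinearMap.id_apply,
      LinearMap.smulRight_apply, innerₛₗ_apply_apply, map_add, map_smul, hL, Submodule.coe_smul,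
      h1, real_inner_self_eq_norm_sq, hu,
      inner_coe_orthogonal, smul_eq_mul]
    module
  have hdetD : LinearMap.det D = a ^ (Module.finrank ℝ E + 1) *
      LinearMap.det (tangentCompression u L) := by
    have h1 : D = (splitAlong u hu).toLinearMap ∘ₗ
        LinearMap.prodMap ((a ^ 2) • LinearMap.id) (a • tangentCompression u L) ∘ₗ
          (splitAlong u hu).symm.toLinearMap := by
      rw [← LinearMap.comp_assoc, ← hconj, LinearMap.comp_assoc, LinearEquiv.comp_symm,
        LinearMap.comp_id]
    rw [h1, LinearMap.det_conj, LinearMap.det_prodMap, LinearMap.det_smul, LinearMap.det_smul,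
      LinearMap.det_id, Module.finrank_self, mul_one, pow_one, ← mul_assoc, ← pow_add]
    have h2 := Submodule.finrank_add_finrank_orthogonal (ℝ ∙ u)
    rw [finrank_span_singleton (by rintro rfl; simp at hu)] at h2
    congr 2
    omega
  rw [hfac, LinearMap.det_comp, LinearMap.det_comp, hdet₁, hdet₂, hdetD, one_mul, mul_one]

end Determinant

section LocalArea

variable {E : Type*} [NormedAddCommGroup E] [InnerProductSpace ℝ E]

theorem HasStrictFDerivAt.eventually_norm_sub_le {F : E → E} {L : E →L[ℝ] E} {u : E}
    (hF : HasStrictFDerivAt F L u) (hu : ‖u‖ = 1) (hL : L u = 0) (hL' : ∀ w, ⟪L w, u⟫ = 0)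
    {ε : ℝ} (hε : 0 < ε) :
    ∀ᶠ r in nhdsWithin (0 : ℝ) (Ioi 0), ∀ y ∈ sphere (0 : E) 1 ∩ ball u r,
      ∀ z ∈ sphere (0 : E) 1 ∩ ball u r, ∃ v : (ℝ ∙ u)ᗮ,
        v = (ℝ ∙ u)ᗮ.orthogonalProjectionOnto y - (ℝ ∙ u)ᗮ.orthogonalProjectionOnto z ∧
        ‖F y - F z - (tangentCompression u L.toLinearMap v : E)‖ ≤ ε * ‖v‖ := by
  obtain ⟨s, hs, happ⟩ := hF.approximates_deriv_on_nhds (c := (ε / 2).toNNReal)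
    (Or.inr (Real.toNNReal_pos.2 (half_pos hε)))
  obtain ⟨r₀, hr₀, hsub⟩ := Metric.mem_nhds_iff.1 hs
  filter_upwards [norm_sub_le_of_mem_sphere_inter_ball hu one_lt_two,
    nhdsWithin_le_nhds (gt_mem_nhds hr₀)] with r hr hrr₀ y hy z hz
  have hle := ball_subset_ball (x := u) hrr₀.le
  have h1 := happ y (hsub (hle hy.2)) z (hsub (hle hz.2))
  refine ⟨_, rfl, ?_⟩
  rw [← map_sub, coe_tangentCompression_proj hu (L := L.toLinearMap) hL hL']
  refine h1.trans ?_
  have h2 := hr y hy z hz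
  have : (ε / 2) * ‖y - z‖ ≤ (ε / 2) * (2 * ‖(ℝ ∙ u)ᗮ.orthogonalProjectionOnto (y - z)‖) := by
    gcongr
  rw [Real.coe_toNNReal _ (half_pos hε).le]
  linarith

variable [FiniteDimensional ℝ E] [MeasurableSpace E] [BorelSpace E]

theorem hausdorffMeasure_image_sphere_inter_ball_le {d : ℝ} (hd0 : 0 ≤ d)
    (hd : d + 1 = Module.finrank ℝ E) {F : E → E} {L : E →L[ℝ] E} {u : E}
    (hF : HasStrictFDerivAt F L u) (hu : ‖u‖ = 1) (hL : L u = 0) (hL' : ∀ w, ⟪L w, u⟫ = 0)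
    (hpos : ∀ w, 0 ≤ ⟪L w, w⟫) {δ : ℝ} (hδ : 0 < δ) {k : ℝ≥0} (hk : 1 < k) :
    ∀ᶠ r in nhdsWithin (0 : ℝ) (Ioi 0), μH[d] (F '' (sphere (0 : E) 1 ∩ ball u r)) ≤
      (k : ℝ≥0∞) ^ d *
        (ENNReal.ofReal |LinearMap.det (tangentCompression u L.toLinearMap +
          δ • LinearMap.id)| * μH[d] (sphere (0 : E) 1 ∩ ball u r)) := by
  set T := tangentCompression u L.toLinearMap with hT
  set P := (ℝ ∙ u)ᗮ.orthogonalProjectionOnto with hP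
  have hk' : (1 : ℝ) < k := by exact_mod_cast hk
  have hTpos : ∀ v, 0 ≤ ⟪T v, v⟫ := by
    intro v
    have h1 := coe_tangentCompression_proj hu (L := L.toLinearMap) hL hL' (v : E)
    rw [Submodule.orthogonalProjectionOnto_mem_subspace_eq_self] at h1
    rw [Submodule.coe_inner, h1]
    exact hpos v
  set Tδ : (ℝ ∙ u)ᗮ →ₗ[ℝ] (ℝ ∙ u)ᗮ := T + δ • LinearMap.id with hTδ_def
  have hTδ : ∀ v, ‖T v‖ ≤ ‖Tδ v‖ ∧ δ * ‖v‖ ≤ ‖Tδ v‖ := by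
    intro v
    have h1 : ‖Tδ v‖ ^ 2 = ‖T v‖ ^ 2 + 2 * (δ * ⟪T v, v⟫) + (δ * ‖v‖) ^ 2 := by
      rw [hTδ_def, LinearMap.add_apply, LinearMap.smul_apply, LinearMap.id_apply, norm_add_sq_real,
        inner_smul_right, norm_smul, Real.norm_eq_abs, abs_of_pos hδ]
    have h2 := mul_nonneg hδ.le (hTpos v)
    constructor
    · exact abs_le_of_sq_le_sq' (by nlinarith [sq_nonneg (δ * ‖v‖)]) (norm_nonneg _) |>.2
    · exact abs_le_of_sq_le_sq' (by nlinarith [sq_nonneg ‖T v‖]) (norm_nonneg _) |>.2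
  filter_upwards [hF.eventually_norm_sub_le hu hL hL' (ε := (k - 1) * δ)
    (mul_pos (by linarith) hδ)] with r hr
  have h1 := hausdorffMeasure_image_le_of_dist_le (F := F)
    (G := fun y => Tδ (P y)) (s := sphere (0 : E) 1 ∩ ball u r) (k := k)
    (fun y hy z hz => by
      obtain ⟨v, hv, hle⟩ := hr y hy z hz
      rw [dist_eq_norm, dist_eq_norm, ← map_sub, ← hv]
      have h2 : ‖F y - F z‖ ≤ (k - 1) * δ * ‖v‖ + ‖T v‖ := by
        have := norm_le_norm_sub_add (F y - F z) (T v : E)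
        rw [← Submodule.coe_norm] at this
        linarith
      have h3 := hTδ v
      have h4 : (k - 1) * (δ * ‖v‖) ≤ (k - 1) * ‖Tδ v‖ :=
        mul_le_mul_of_nonneg_left h3.2 (by linarith)
      nlinarith [h3.1]) hd0
  refine h1.trans ?_
  rw [← image_image Tδ P,
    hausdorffMeasure_image_linearMap (finrank_orthogonal_singleton_eq hd hu)]
  gcongr
  simpa using (ℝ ∙ u)ᗮ.lipschitzWith_orthogonalProjectionOnto.hausdorffMeasure_image_le hd0
    (sphere (0 : E) 1 ∩ ball u r)

theorem le_hausdorffMeasure_image_sphere_inter_ball {d : ℝ} (hd0 : 0 ≤ d)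
    (hd : d + 1 = Module.finrank ℝ E) {F : E → E} {L : E →L[ℝ] E} {u : E}
    (hF : HasStrictFDerivAt F L u) (hu : ‖u‖ = 1) (hL : L u = 0) (hL' : ∀ w, ⟪L w, u⟫ = 0)
    (hdet : LinearMap.det (tangentCompression u L.toLinearMap) ≠ 0) {k : ℝ≥0} (hk : 1 < k) :
    ∀ᶠ r in nhdsWithin (0 : ℝ) (Ioi 0),
      ENNReal.ofReal |LinearMap.det (tangentCompression u L.toLinearMap)| *
        μH[d] (sphere (0 : E) 1 ∩ ball u r) ≤
      (k : ℝ≥0∞) ^ d * ((k : ℝ≥0∞) ^ d * μH[d] (F '' (sphere (0 : E) 1 ∩ ball u r))) := by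
  set T := tangentCompression u L.toLinearMap with hT
  set P := (ℝ ∙ u)ᗮ.orthogonalProjectionOnto with hP
  have hk' : (1 : ℝ) < k := by exact_mod_cast hk
  obtain ⟨C, hC, hanti⟩ := T.exists_antilipschitzWith
    ((LinearMap.isUnit_iff_ker_eq_bot T).1 ((LinearMap.isUnit_iff_isUnit_det T).2
      (isUnit_iff_ne_zero.2 hdet)))
  have hC' : (0 : ℝ) < C := by exact_mod_cast hC
  have hCT : ∀ v, ‖v‖ ≤ C * ‖T v‖ := fun v => by
    simpa using hanti.le_mul_dist v 0
  filter_upwards [hausdorffMeasure_sphere_inter_ball_le hd0 hu hk,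
    hF.eventually_norm_sub_le hu hL hL' (ε := (1 - (k : ℝ)⁻¹) / C)
    (div_pos (sub_pos.2 (inv_lt_one_of_one_lt₀ hk')) hC')] with r hr1 hr2
  have h1 := hausdorffMeasure_image_le_of_dist_le (F := fun y => T (P y))
    (G := F) (s := sphere (0 : E) 1 ∩ ball u r) (k := k)
    (fun y hy z hz => by
      obtain ⟨v, hv, hle⟩ := hr2 y hy z hz
      rw [dist_eq_norm, dist_eq_norm, ← map_sub, ← hv]
      have h2 : ‖T v‖ ≤ ‖F y - F z‖ + (1 - (k : ℝ)⁻¹) / C * ‖v‖ := by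
        have := norm_le_norm_add_norm_sub (F y - F z) (T v : E)
        rw [← Submodule.coe_norm] at this
        linarith
      have h3 : (1 - (k : ℝ)⁻¹) / C * ‖v‖ ≤ (1 - (k : ℝ)⁻¹) * ‖T v‖ := by
        rw [div_mul_eq_mul_div, div_le_iff₀ hC', mul_assoc]
        refine mul_le_mul_of_nonneg_left ((hCT v).trans_eq (mul_comm _ _)) ?_
        exact (sub_pos.2 (inv_lt_one_of_one_lt₀ hk')).le
      have h4 : (k : ℝ)⁻¹ * ‖T v‖ ≤ ‖F y - F z‖ := by nlinarith
      rwa [inv_mul_le_iff₀ (by linarith)] at h4) hd0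
  rw [← image_image T P,
    hausdorffMeasure_image_linearMap (finrank_orthogonal_singleton_eq hd hu)] at h1
  calc _ ≤ ENNReal.ofReal |LinearMap.det T| *
        ((k : ℝ≥0∞) ^ d * μH[d] (P '' (sphere (0 : E) 1 ∩ ball u r))) := by gcongr
    _ = (k : ℝ≥0∞) ^ d * (ENNReal.ofReal |LinearMap.det T| *
        μH[d] (P '' (sphere (0 : E) 1 ∩ ball u r))) := by ring
    _ ≤ _ := by gcongr

end LocalArea

section LocalDensity

variable {X : Type*} [PseudoMetricSpace X] [MeasurableSpace X] [OpensMeasurableSpace X]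
  {μ : Measure X} {s : Set X} {φ : X → ℝ≥0∞} {u : X} {m : ℝ≥0∞}

theorem eventually_mul_le_setLIntegral_ball (hs : MeasurableSet s)
    (hφ : ContinuousWithinAt φ s u) (hm : m < φ u) :
    ∀ᶠ r in nhdsWithin (0 : ℝ) (Ioi 0), m * μ (s ∩ ball u r) ≤ ∫⁻ y in s ∩ ball u r, φ y ∂μ := by
  obtain ⟨r₀, hr₀, h⟩ := Metric.mem_nhdsWithin_iff.1 (hφ.eventually (lt_mem_nhds hm))
  filter_upwards [nhdsWithin_le_nhds (gt_mem_nhds hr₀)] with r hr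
  rw [← setLIntegral_const]
  exact setLIntegral_mono' (hs.inter measurableSet_ball)
    fun y hy => (h ⟨ball_subset_ball hr.le hy.2, hy.1⟩).le

theorem eventually_setLIntegral_ball_le_mul (hs : MeasurableSet s)
    (hφ : ContinuousWithinAt φ s u) (hm : φ u < m) :
    ∀ᶠ r in nhdsWithin (0 : ℝ) (Ioi 0), ∫⁻ y in s ∩ ball u r, φ y ∂μ ≤ m * μ (s ∩ ball u r) := by
  obtain ⟨r₀, hr₀, h⟩ := Metric.mem_nhdsWithin_iff.1 (hφ.eventually (gt_mem_nhds hm))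
  filter_upwards [nhdsWithin_le_nhds (gt_mem_nhds hr₀)] with r hr
  rw [← setLIntegral_const]
  exact setLIntegral_mono' (hs.inter measurableSet_ball)
    fun y hy => (h ⟨ball_subset_ball hr.le hy.2, hy.1⟩).le

theorem ENNReal.le_of_forall_one_lt_le_rpow_mul {a b : ℝ≥0∞} {p : ℝ}
    (h : ∀ k : ℝ≥0, 1 < k → a ≤ (k : ℝ≥0∞) ^ p * b) : a ≤ b := by
  have hlim : Tendsto (fun k : ℝ≥0 => (k : ℝ≥0∞) ^ p * b) (nhdsWithin 1 (Ioi 1))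
      (nhds (((1 : ℝ≥0) : ℝ≥0∞) ^ p * b)) :=
    ENNReal.Tendsto.mul_const (((ENNReal.continuous_rpow_const.comp
      ENNReal.continuous_coe).tendsto 1).mono_left nhdsWithin_le_nhds) (Or.inl (by simp))
  rw [ENNReal.coe_one, ENNReal.one_rpow, one_mul] at hlim
  exact ge_of_tendsto hlim (by filter_upwards [self_mem_nhdsWithin] with k hk using h k hk)

end LocalDensity

section CurvatureFunction

variable {n : ℕ} {K : Set (Eu n)}

theorem isOuterNormal_gaussMap {x : Eu n} (h : gaussMap K x ≠ 0) :
    IsOuterNormal K x (gaussMap K x) := by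
  unfold gaussMap at h ⊢
  split_ifs at h ⊢ with h1
  · exact h1.choose_spec
  · exact absurd rfl h

theorem isOuterNormal_gaussMap_of_isOuterNormal {x u : Eu n} (h : IsOuterNormal K x u) :
    IsOuterNormal K x (gaussMap K x) := by
  have h1 : ∃ u, IsOuterNormal K x u := ⟨u, h⟩
  unfold gaussMap
  rw [dif_pos h1]
  exact h1.choose_spec

theorem IsOuterNormal.ne_zero {x u : Eu n} (h : IsOuterNormal K x u) : u ≠ 0 :=
  norm_ne_zero_iff.1 (by rw [h.1]; exact one_ne_zero)

theorem IsOuterNormal.inner_eq_suppFn (hK : IsConvexBody K) {x u : Eu n}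
    (h : IsOuterNormal K x u) (hx : x ∈ K) : ⟪x, u⟫ = suppFn K u := by
  refine le_antisymm (inner_le_suppFn hK hx u) ?_
  obtain ⟨y, hy, hyu⟩ := exists_inner_eq_suppFn hK u
  exact hyu ▸ h.2 y hy

variable (hK : IsConvexBody K) (hh : ContDiffOn ℝ 3 (suppFn K) {(0 : Eu n)}ᶜ)
include hK hh

theorem IsOuterNormal.gradient_suppFn {x u : Eu n} (h : IsOuterNormal K x u) (hx : x ∈ K) :
    gradient (suppFn K) u = x :=
  gradient_suppFn_eq hK (differentiableAt_suppFn hh h.ne_zero) hx (h.inner_eq_suppFn hK hx)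

theorem isOuterNormal_gradient_suppFn {u : Eu n} (hu : ‖u‖ = 1) :
    IsOuterNormal K (gradient (suppFn K) u) u := by
  have hu0 : u ≠ 0 := norm_ne_zero_iff.1 (by rw [hu]; exact one_ne_zero)
  refine ⟨hu, fun y hy => ?_⟩
  rw [inner_gradient_suppFn_self hK (fun u hu => differentiableAt_suppFn hh hu) hu0]
  exact inner_le_suppFn hK hy u

theorem gradient_suppFn_mem_frontier {u : Eu n} (hu : u ≠ 0) :
    gradient (suppFn K) u ∈ frontier K := by
  have hmem := gradient_suppFn_mem hK (fun u hu => differentiableAt_suppFn hh hu) hu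
  refine ⟨subset_closure hmem, fun hint => ?_⟩
  have hmax : IsLocalMax (fun x : Eu n => innerSL ℝ u x) (gradient (suppFn K) u) := by
    filter_upwards [mem_interior_iff_mem_nhds.1 hint] with x hx
    simp only [innerSL_apply_apply, real_inner_comm _ u]
    rw [inner_gradient_suppFn_self hK (fun u hu => differentiableAt_suppFn hh hu) hu]
    exact inner_le_suppFn hK hx u
  have h := congrArg (fun L => L u) (hmax.hasFDerivAt_eq_zero (innerSL ℝ u).hasFDerivAt)
  simp [hu] at h

theorem gaussMap_preimage_subset_image_gradient {s : Set (Eu n)} (hs : (0 : Eu n) ∉ s) :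
    {x ∈ frontier K | gaussMap K x ∈ s} ⊆ gradient (suppFn K) '' (sphere 0 1 ∩ s) := by
  rintro x ⟨hx, hxs⟩
  have hnor := isOuterNormal_gaussMap (K := K) (x := x) (fun h => hs (h ▸ hxs))
  exact ⟨gaussMap K x, ⟨mem_sphere_zero_iff_norm.2 hnor.1, hxs⟩,
    hnor.gradient_suppFn hK hh (hK.2.1.isClosed.frontier_subset hx)⟩

variable {ftil : Eu n → ℝ} (hd0 : (0 : ℝ) ≤ (n : ℝ) - 1)
  (hfc : ContinuousOn ftil (sphere (0 : Eu n) 1))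
  (hfdens : ∀ ω : Set (Eu n), MeasurableSet ω →
      μH[(n:ℝ) - 1] {x ∈ frontier K | gaussMap K x ∈ ω} =
        ∫⁻ u in ω ∩ sphere (0 : Eu n) 1, ENNReal.ofReal (ftil u) ∂(μH[(n:ℝ) - 1]))
include hd0 hfc hfdens

theorem ofReal_density_le_abs_det {u : Eu n} (hu : ‖u‖ = 1) :
    ENNReal.ofReal (ftil u) ≤ ENNReal.ofReal |LinearMap.det
      (tangentCompression u (fderiv ℝ (gradient (suppFn K)) u).toLinearMap)| := by
  have hu0 : u ≠ 0 := norm_ne_zero_iff.1 (by rw [hu]; exact one_ne_zero)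
  have hd : (n : ℝ) - 1 + 1 = Module.finrank ℝ (Eu n) := by simp
  set T := tangentCompression u (fderiv ℝ (gradient (suppFn K)) u).toLinearMap with hT
  have hφ : ContinuousWithinAt (fun u => ENNReal.ofReal (ftil u)) (sphere (0 : Eu n) 1) u :=
    ENNReal.continuous_ofReal.continuousAt.comp_continuousWithinAt
      (hfc u (mem_sphere_zero_iff_norm.2 hu))
  have hstrict := (contDiffAt_gradient_suppFn hh hu0).hasStrictFDerivAt (by norm_num)
  have key : ∀ δ : ℝ, 0 < δ → ENNReal.ofReal (ftil u) ≤
      ENNReal.ofReal |LinearMap.det (T + δ • LinearMap.id)| := by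
    intro δ hδ
    refine ENNReal.le_of_forall_one_lt_le_rpow_mul (p := (n : ℝ) - 1) fun k hk =>
      le_of_forall_lt_imp_le_of_dense fun m hm => ?_
    obtain ⟨r, ⟨⟨h1, h2⟩, hr0⟩, hr1⟩ :=
      (((eventually_mul_le_setLIntegral_ball (μ := μH[(n : ℝ) - 1])
        isClosed_sphere.measurableSet hφ hm).and
      (hausdorffMeasure_image_sphere_inter_ball_le hd0 hd hstrict hu
        (fderiv_gradient_suppFn_self hK hh hu0) (inner_fderiv_gradient_suppFn hK hh hu0)
        (inner_fderiv_gradient_suppFn_nonneg hK hh hu0) hδ hk)).and self_mem_nhdsWithin).and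
        (nhdsWithin_le_nhds (gt_mem_nhds one_pos)) |>.exists
    have hpos := hausdorffMeasure_sphere_inter_ball_pos hd0 hd hu (r := r) hr0
    have hfin := measure_inter_lt_top_of_left_ne_top (t := ball u r)
      (hausdorffMeasure_sphere_lt_top hd0 hd).ne
    have hnot : (0 : Eu n) ∉ ball u r := by simpa [hu] using hr1.le
    rw [← ENNReal.mul_le_mul_iff_left hpos.ne' hfin.ne, mul_assoc]
    refine h1.trans (le_trans ?_ h2)
    rw [inter_comm, ← hfdens _ measurableSet_ball, inter_comm]
    exact measure_mono (gaussMap_preimage_subset_image_gradient hK hh hnot)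
  have hcont : Continuous fun δ : ℝ => ENNReal.ofReal |LinearMap.det (T + δ • LinearMap.id)| := by
    have h1 : ∀ δ : ℝ, LinearMap.det (T + δ • LinearMap.id) =
        (LinearMap.toContinuousLinearMap T + δ • ContinuousLinearMap.id ℝ _).det := fun δ => rfl
    simp_rw [h1]
    exact ENNReal.continuous_ofReal.comp (ContinuousLinearMap.continuous_det.comp
      (by fun_prop)).abs
  have hlim := (hcont.tendsto' 0 (ENNReal.ofReal |LinearMap.det T|) (by simp)).mono_left
    (nhdsWithin_le_nhds (s := Ioi (0 : ℝ)))
  exact ge_of_tendsto hlim (by filter_upwards [self_mem_nhdsWithin] with δ hδ using key δ hδ)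

theorem abs_det_le_ofReal_density
    (hgauss : ∀ u : Eu n, ‖u‖ = 1 → gaussMap K (gradient (suppFn K) u) = u)
    {u : Eu n} (hu : ‖u‖ = 1) (hdet : LinearMap.det
      (tangentCompression u (fderiv ℝ (gradient (suppFn K)) u).toLinearMap) ≠ 0) :
    ENNReal.ofReal |LinearMap.det
      (tangentCompression u (fderiv ℝ (gradient (suppFn K)) u).toLinearMap)| ≤
        ENNReal.ofReal (ftil u) := by
  have hu0 : u ≠ 0 := norm_ne_zero_iff.1 (by rw [hu]; exact one_ne_zero)
  have hd : (n : ℝ) - 1 + 1 = Module.finrank ℝ (Eu n) := by simp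
  have hφ : ContinuousWithinAt (fun u => ENNReal.ofReal (ftil u)) (sphere (0 : Eu n) 1) u :=
    ENNReal.continuous_ofReal.continuousAt.comp_continuousWithinAt
      (hfc u (mem_sphere_zero_iff_norm.2 hu))
  have hstrict := (contDiffAt_gradient_suppFn hh hu0).hasStrictFDerivAt (by norm_num)
  refine le_of_forall_gt_imp_ge_of_dense fun m hm =>
    ENNReal.le_of_forall_one_lt_le_rpow_mul (p := (n : ℝ) - 1 + ((n : ℝ) - 1)) fun k hk => ?_
  rw [ENNReal.rpow_add_of_nonneg _ _ hd0 hd0]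
  obtain ⟨r, ⟨h1, h2⟩, hr0⟩ :=
    ((eventually_setLIntegral_ball_le_mul (μ := μH[(n : ℝ) - 1])
        isClosed_sphere.measurableSet hφ hm).and
      (le_hausdorffMeasure_image_sphere_inter_ball hd0 hd hstrict hu
        (fderiv_gradient_suppFn_self hK hh hu0) (inner_fderiv_gradient_suppFn hK hh hu0)
        hdet hk)).and self_mem_nhdsWithin |>.exists
  have hpos := hausdorffMeasure_sphere_inter_ball_pos hd0 hd hu (r := r) hr0
  have hfin := measure_inter_lt_top_of_left_ne_top (t := ball u r)
    (hausdorffMeasure_sphere_lt_top hd0 hd).ne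
  rw [← ENNReal.mul_le_mul_iff_left hpos.ne' hfin.ne]
  refine h2.trans ?_
  rw [mul_assoc, mul_assoc]
  gcongr
  refine le_trans (measure_mono ?_) ((hfdens _ measurableSet_ball).trans_le (le_of_eq_of_le
    (by rw [inter_comm]) h1))
  rintro _ ⟨v, ⟨hv1, hv2⟩, rfl⟩
  have hv1 := mem_sphere_zero_iff_norm.1 hv1
  refine ⟨gradient_suppFn_mem_frontier hK hh (norm_ne_zero_iff.1 (by simp [hv1])), ?_⟩
  rwa [hgauss v hv1]

end CurvatureFunction

section DualityMap

variable {n : ℕ} {K : Set (Eu n)}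

/-- The radial-to-normal change of variables `y ↦ h(y) ∇h(y)`, with `h` the support function. -/
def dualityMap (K : Set (Eu n)) (y : Eu n) : Eu n := suppFn K y • gradient (suppFn K) y

variable (hK : IsConvexBody K) (h0 : (0 : Eu n) ∈ interior K)
  (hh : ContDiffOn ℝ 3 (suppFn K) {(0 : Eu n)}ᶜ)

section
include hK hh

theorem dualityMap_smul {c : ℝ} (hc : 0 < c) (y : Eu n) :
    dualityMap K (c • y) = c • dualityMap K y := by
  rcases eq_or_ne y 0 with rfl | hy
  · have : suppFn K 0 = 0 := by simpa using suppFn_smul hK le_rfl (0 : Eu n)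
    simp [dualityMap, this]
  rw [dualityMap, dualityMap, suppFn_smul hK hc.le,
    gradient_suppFn_smul hK (fun u hu => differentiableAt_suppFn hh hu) hy hc, smul_smul]

omit hK in
theorem hasFDerivAt_dualityMap {y : Eu n} (hy : y ≠ 0) :
    HasFDerivAt (dualityMap K) (suppFn K y • fderiv ℝ (gradient (suppFn K)) y +
      (fderiv ℝ (suppFn K) y).smulRight (gradient (suppFn K) y)) y :=
  (differentiableAt_suppFn hh hy).hasFDerivAt.smul
    ((contDiffAt_gradient_suppFn hh hy).differentiableAt (by norm_num)).hasFDerivAt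

theorem fderiv_dualityMap_smul {c : ℝ} (hc : 0 < c) (y : Eu n) :
    fderiv ℝ (dualityMap K) (c • y) = fderiv ℝ (dualityMap K) y := by
  have h1 : (fun y => dualityMap K (c • y)) = fun y => c • dualityMap K y :=
    funext (dualityMap_smul hK hh hc)
  have h2 := fderiv_comp_smul (𝕜 := ℝ) (f := dualityMap K) (x := y) c
  rw [h1, show (fun y => c • dualityMap K y) = c • dualityMap K from rfl,
    fderiv_const_smul_field] at h2
  exact (smul_right_injective _ hc.ne' h2).symm

end

include hK h0 hh

theorem det_fderiv_dualityMap {u : Eu n} (hu : ‖u‖ = 1) :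
    (fderiv ℝ (dualityMap K) u).det = suppFn K u ^ (n + 1) * LinearMap.det
      (tangentCompression u (fderiv ℝ (gradient (suppFn K)) u).toLinearMap) := by
  have hu0 : u ≠ 0 := norm_ne_zero_iff.1 (by rw [hu]; exact one_ne_zero)
  have hx := inner_gradient_suppFn_self hK (fun u hu => differentiableAt_suppFn hh hu) hu0
  have h := det_smul_add_inner_smul hu (L := (fderiv ℝ (gradient (suppFn K)) u).toLinearMap)
    (fderiv_gradient_suppFn_self hK hh hu0) (inner_fderiv_gradient_suppFn hK hh hu0)
    (gradient (suppFn K) u) (by rw [hx]; exact (suppFn_pos hK h0 hu0).ne')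
  rw [hx, finrank_euclideanSpace_fin] at h
  rw [← h, (hasFDerivAt_dualityMap hh hu0).fderiv, ContinuousLinearMap.det]
  congr 1
  ext1 w
  simp

theorem suppFn_eq_of_dualityMap_eq {y z : Eu n} (hy : y ≠ 0) (hz : z ≠ 0)
    (h : dualityMap K y = dualityMap K z) : suppFn K y = suppFn K z := by
  have hd := fun (u : Eu n) (hu : u ≠ 0) => differentiableAt_suppFn hh hu
  have key : ∀ y z : Eu n, y ≠ 0 → z ≠ 0 → dualityMap K y = dualityMap K z →
      suppFn K z ≤ suppFn K y := by
    intro y z hy hz h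
    have h1 := congrArg (fun x => ⟪x, z⟫) h
    simp only [dualityMap, real_inner_smul_left, inner_gradient_suppFn_self hK hd hz] at h1
    have h2 := mul_le_mul_of_nonneg_left (inner_le_suppFn hK (gradient_suppFn_mem hK hd hy) z)
      (suppFn_pos hK h0 hy).le
    rw [h1] at h2
    exact le_of_mul_le_mul_right h2 (suppFn_pos hK h0 hz)
  exact le_antisymm (key z y hz hy h.symm) (key y z hy hz h)

theorem dualityMap_segment {y z : Eu n} (hy : y ≠ 0) (hz : z ≠ 0)
    (h : dualityMap K y = dualityMap K z) {t : ℝ} (ht : t ∈ Icc (0 : ℝ) 1) :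
    dualityMap K (y + t • (z - y)) = dualityMap K y := by
  have hd := fun (u : Eu n) (hu : u ≠ 0) => differentiableAt_suppFn hh hu
  have heq := suppFn_eq_of_dualityMap_eq hK h0 hh hy hz h
  have hypos := suppFn_pos hK h0 hy
  have hx : gradient (suppFn K) y = gradient (suppFn K) z := by
    rw [dualityMap, dualityMap, ← heq] at h
    exact smul_right_injective _ hypos.ne' h
  have hin : ⟪gradient (suppFn K) y, y + t • (z - y)⟫ = suppFn K y := by
    rw [inner_add_right, inner_smul_right, inner_sub_right, inner_gradient_suppFn_self hK hd hy,
      hx, inner_gradient_suppFn_self hK hd hz, heq]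
    ring
  have hsupp : suppFn K (y + t • (z - y)) = suppFn K y := by
    refine le_antisymm ?_ (hin ▸ inner_le_suppFn hK (gradient_suppFn_mem hK hd hy) _)
    obtain ⟨x, hxK, hxu⟩ := exists_inner_eq_suppFn hK (y + t • (z - y))
    have h1 := inner_le_suppFn hK hxK y
    have h2 := inner_le_suppFn hK hxK z
    rw [← heq] at h2
    rw [← hxu, inner_add_right, inner_smul_right, inner_sub_right]
    nlinarith [ht.1, ht.2]
  have hne : y + t • (z - y) ≠ 0 := fun h => by
    rw [h, inner_zero_right] at hin
    exact hypos.ne hin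
  rw [dualityMap, dualityMap, hsupp, gradient_suppFn_eq hK (hd _ hne)
    (gradient_suppFn_mem hK hd hy) (hin.trans hsupp.symm)]

theorem injOn_dualityMap (hdet : ∀ y : Eu n, y ≠ 0 → (fderiv ℝ (dualityMap K) y).det ≠ 0) :
    InjOn (dualityMap K) {(0 : Eu n)}ᶜ := by
  intro y hy z hz h
  have h1 := (hasFDerivAt_dualityMap hh hy).differentiableAt.hasFDerivAt.hasLineDerivAt (z - y)
  have h1 : HasDerivAt (fun t : ℝ => dualityMap K (y + t • (z - y)))
    (fderiv ℝ (dualityMap K) y (z - y)) 0 := h1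
  have h2 : HasDerivWithinAt (fun t : ℝ => dualityMap K (y + t • (z - y))) 0 (Icc 0 1) 0 :=
    (hasDerivWithinAt_const (0 : ℝ) (Icc (0 : ℝ) 1) (dualityMap K y)).congr
      (fun t ht => dualityMap_segment hK h0 hh hy hz h ht) (by simp)
  have h3 := (uniqueDiffOn_Icc_zero_one (0 : ℝ) (by simp)).eq_deriv _ h1.hasDerivWithinAt h2
  have h4 : Function.Injective (fderiv ℝ (dualityMap K) y).toLinearMap :=
    LinearMap.ker_eq_bot.1 ((LinearMap.isUnit_iff_ker_eq_bot _).1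
      ((LinearMap.isUnit_iff_isUnit_det _).2 (isUnit_iff_ne_zero.2 (hdet y hy))))
  exact (sub_eq_zero.1 (h4 (h3.trans (map_zero _).symm))).symm

theorem gaussMap_gradient_suppFn
    (hdet : ∀ y : Eu n, y ≠ 0 → (fderiv ℝ (dualityMap K) y).det ≠ 0) {u : Eu n} (hu : ‖u‖ = 1) :
    gaussMap K (gradient (suppFn K) u) = u := by
  have hd := fun (u : Eu n) (hu : u ≠ 0) => differentiableAt_suppFn hh hu
  have hu0 : u ≠ 0 := norm_ne_zero_iff.1 (by rw [hu]; exact one_ne_zero)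
  have hv := (isOuterNormal_gaussMap_of_isOuterNormal
    (isOuterNormal_gradient_suppFn hK hh hu))
  set v := gaussMap K (gradient (suppFn K) u) with hv_def
  have hN := hv.gradient_suppFn hK hh (gradient_suppFn_mem hK hd hu0)
  have hc : 0 < suppFn K u / suppFn K v :=
    div_pos (suppFn_pos hK h0 hu0) (suppFn_pos hK h0 hv.ne_zero)
  have h1 : dualityMap K ((suppFn K u / suppFn K v) • v) = dualityMap K u := by
    rw [dualityMap_smul hK hh hc, dualityMap, dualityMap, smul_smul, hN,
      div_mul_cancel₀ _ (suppFn_pos hK h0 hv.ne_zero).ne']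
  have h2 := injOn_dualityMap hK h0 hh hdet (smul_ne_zero hc.ne' hv.ne_zero) hu0 h1
  have h3 := congrArg norm h2
  rw [norm_smul, hv.1, hu, mul_one, Real.norm_eq_abs, abs_of_pos hc] at h3
  rwa [h3, one_smul] at h2

theorem image_dualityMap : dualityMap K '' {(0 : Eu n)}ᶜ = {(0 : Eu n)}ᶜ := by
  have hd := fun (u : Eu n) (hu : u ≠ 0) => differentiableAt_suppFn hh hu
  apply Subset.antisymm
  · rintro _ ⟨y, hy, rfl⟩ h
    have h1 := congrArg (fun x => ⟪x, y⟫) (mem_singleton_iff.1 h)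
    simp only [dualityMap, real_inner_smul_left, inner_gradient_suppFn_self hK hd hy,
      inner_zero_left, mul_self_eq_zero] at h1
    exact (suppFn_pos hK h0 hy).ne' h1
  · intro x hx
    have hx0 : x ≠ 0 := hx
    have hne : (sphere (0 : Eu n) 1).Nonempty :=
      ⟨(‖x‖⁻¹) • x, by simp [norm_smul, norm_ne_zero_iff.2 hx0]⟩
    have hsph : ∀ u ∈ sphere (0 : Eu n) 1, u ≠ 0 := fun u hu => ne_of_mem_sphere hu one_ne_zero
    obtain ⟨v, hv, hmax⟩ := (isCompact_sphere (0 : Eu n) 1).exists_isMaxOn hne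
      (f := fun u => ⟪x, u⟫ / suppFn K u)
      (ContinuousOn.div (by fun_prop) (hh.continuousOn.mono fun u hu => hsph u hu)
        fun u hu => (suppFn_pos hK h0 (hsph u hu)).ne')
    have hv0 := hsph v hv
    have hvpos := suppFn_pos hK h0 hv0
    set ρ := ⟪x, v⟫ / suppFn K v with hρ
    have hle : ∀ y, ⟪x, y⟫ ≤ ρ * suppFn K y := by
      intro y
      rcases eq_or_ne y 0 with rfl | hy
      · have : suppFn K 0 = 0 := by simpa using suppFn_smul hK le_rfl (0 : Eu n)
        simp [this]
      have hy' : 0 < ‖y‖ := norm_pos_iff.2 hy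
      have h1 : ⟪x, ‖y‖⁻¹ • y⟫ / suppFn K (‖y‖⁻¹ • y) ≤ ρ :=
        hmax (show ‖y‖⁻¹ • y ∈ sphere (0 : Eu n) 1 by simp [norm_smul, hy'.ne'])
      rw [inner_smul_right, suppFn_smul hK (by positivity),
        mul_div_mul_left _ _ (inv_ne_zero hy'.ne'), div_le_iff₀ (suppFn_pos hK h0 hy)] at h1
      exact h1
    have hρpos : 0 < ρ := by
      have h1 := hle x
      rw [real_inner_self_eq_norm_sq] at h1
      exact pos_of_mul_pos_left ((pow_pos (norm_pos_iff.2 hx0) 2).trans_le h1)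
        (suppFn_pos hK h0 hx0).le
    have hN : gradient (suppFn K) v = ρ⁻¹ • x := by
      refine gradient_suppFn_eq_of_forall_inner_le (hd v hv0) (fun w => ?_) ?_
      · rw [real_inner_smul_left, inv_mul_le_iff₀ hρpos]
        exact hle w
      · rw [real_inner_smul_left, inv_mul_eq_iff_eq_mul₀ hρpos.ne', hρ,
          div_mul_cancel₀ _ hvpos.ne']
    refine ⟨(ρ / suppFn K v) • v, smul_ne_zero (div_pos hρpos hvpos).ne' hv0, ?_⟩
    rw [dualityMap_smul hK hh (div_pos hρpos hvpos), dualityMap, hN, smul_smul, smul_smul,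
      div_mul_cancel₀ _ hvpos.ne', mul_inv_cancel₀ hρpos.ne', one_smul]

end DualityMap

section IntegrationByParts

variable {E : Type*} [NormedAddCommGroup E] [InnerProductSpace ℝ E] [FiniteDimensional ℝ E]
  [MeasurableSpace E] [BorelSpace E] {F : E → ℝ} {C : ℝ≥0}

theorem LipschitzWith.integrable_mul_lineDeriv (hF : LipschitzWith C F)
    (hc : HasCompactSupport F) (v : E) {g : E → ℝ} (hg : Continuous g) :
    Integrable fun x => g x * lineDeriv ℝ F x v := by
  have h1 : IntegrableOn (fun x => lineDeriv ℝ F x v * g x) (tsupport F) volume :=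
    ((hF.locallyIntegrable_lineDeriv v).integrableOn_isCompact hc).mul_continuousOn
      hg.continuousOn hc
  refine ((integrableOn_iff_integrable_of_support_subset fun x hx => ?_).1 h1).congr
    (ae_of_all _ fun x => mul_comm _ _)
  by_contra h
  refine hx ?_
  simp only
  rw [((notMem_tsupport_iff_eventuallyEq.1 h).lineDeriv_eq : lineDeriv ℝ F x v = _)]
  simp [lineDeriv]

theorem LipschitzWith.integral_fderiv_apply_self (hF : LipschitzWith C F)
    (hc : HasCompactSupport F) (B : E →L[ℝ] E) :
    ∫ x, fderiv ℝ F x (B x) = -LinearMap.trace ℝ E B.toLinearMap * ∫ x, F x := by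
  set b := stdOrthonormalBasis ℝ E
  have h1 : ∀ᵐ x : E, fderiv ℝ F x (B x) = ∑ i, ⟪b i, B x⟫ * lineDeriv ℝ F x (b i) := by
    filter_upwards [hF.ae_differentiableAt] with x hx
    conv_lhs => rw [← b.sum_repr' (B x)]
    rw [map_sum]
    exact Finset.sum_congr rfl fun i _ => by rw [map_smul, smul_eq_mul, hx.lineDeriv_eq_fderiv]
  have h2 : ∀ i, ∫ x, ⟪b i, B x⟫ * lineDeriv ℝ F x (b i) = -⟪b i, B (b i)⟫ * ∫ x, F x := by
    intro i
    have h3 := LipschitzWith.integral_lineDeriv_mul_eq (μ := volume)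
      ((innerSL ℝ (b i) ∘L B).lipschitz) hF hc (-(b i))
    simp only [neg_neg] at h3
    simp_rw [mul_comm ⟪b i, B _⟫]
    rw [← integral_const_mul]
    refine Eq.trans h3.symm (integral_congr_ae (ae_of_all _ fun x => ?_))
    simp only
    rw [(innerSL ℝ (b i) ∘L B).differentiableAt.lineDeriv_eq_fderiv, ContinuousLinearMap.fderiv]
    simp
  rw [integral_congr_ae h1, integral_finsetSum _ fun i _ =>
    hF.integrable_mul_lineDeriv hc (b i) (by fun_prop), LinearMap.trace_eq_sum_inner _ b,
    Finset.sum_congr rfl fun i _ => h2 i, ← Finset.sum_mul, Finset.sum_neg_distrib]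
  rfl

omit [MeasurableSpace E] [BorelSpace E] in
theorem trace_adjoint (B : E →L[ℝ] E) :
    LinearMap.trace ℝ E (ContinuousLinearMap.adjoint B).toLinearMap =
      LinearMap.trace ℝ E B.toLinearMap := by
  rw [LinearMap.trace_eq_sum_inner _ (stdOrthonormalBasis ℝ E),
    LinearMap.trace_eq_sum_inner _ (stdOrthonormalBasis ℝ E)]
  refine Finset.sum_congr rfl fun i _ => ?_
  simp only [ContinuousLinearMap.coe_coe]
  rw [ContinuousLinearMap.adjoint_inner_right, real_inner_comm]

end IntegrationByParts

section Density

variable {n : ℕ} {K : Set (Eu n)} (hK : IsConvexBody K) (h0 : (0 : Eu n) ∈ interior K)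
  (hh : ContDiffOn ℝ 3 (suppFn K) {(0 : Eu n)}ᶜ) {ftil : Eu n → ℝ} (hd0 : (0 : ℝ) ≤ (n : ℝ) - 1)
  (hfc : ContinuousOn ftil (sphere (0 : Eu n) 1))
  (hfpos : ∀ u ∈ sphere (0 : Eu n) 1, 0 < ftil u)
  (hfdens : ∀ ω : Set (Eu n), MeasurableSet ω →
      μH[(n:ℝ) - 1] {x ∈ frontier K | gaussMap K x ∈ ω} =
        ∫⁻ u in ω ∩ sphere (0 : Eu n) 1, ENNReal.ofReal (ftil u) ∂(μH[(n:ℝ) - 1]))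
include hK h0 hh hd0 hfc hfpos hfdens

omit h0 in
theorem det_tangentCompression_ne_zero {u : Eu n} (hu : ‖u‖ = 1) : LinearMap.det
    (tangentCompression u (fderiv ℝ (gradient (suppFn K)) u).toLinearMap) ≠ 0 := by
  intro h
  have h1 := ofReal_density_le_abs_det hK hh hd0 hfc hfdens hu
  rw [h, abs_zero, ENNReal.ofReal_zero, nonpos_iff_eq_zero, ENNReal.ofReal_eq_zero] at h1
  exact h1.not_gt (hfpos u (mem_sphere_zero_iff_norm.2 hu))

theorem det_fderiv_dualityMap_ne_zero {y : Eu n} (hy : y ≠ 0) :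
    (fderiv ℝ (dualityMap K) y).det ≠ 0 := by
  have hu : ‖‖y‖⁻¹ • y‖ = 1 := by simp [norm_smul, norm_ne_zero_iff.2 hy]
  rw [← fderiv_dualityMap_smul hK hh (inv_pos.2 (norm_pos_iff.2 hy)),
    det_fderiv_dualityMap hK h0 hh hu]
  exact mul_ne_zero (pow_pos (suppFn_pos hK h0 (norm_ne_zero_iff.1 (by simp [hu]))) _).ne'
    (det_tangentCompression_ne_zero hK hh hd0 hfc hfpos hfdens hu)

theorem abs_det_fderiv_dualityMap_of_norm_eq_one {u : Eu n} (hu : ‖u‖ = 1) :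
    |(fderiv ℝ (dualityMap K) u).det| = suppFn K u ^ (n + 1) * ftil u := by
  have hpos := hfpos u (mem_sphere_zero_iff_norm.2 hu)
  have hne := det_tangentCompression_ne_zero hK hh hd0 hfc hfpos hfdens hu
  have hgauss : ∀ v : Eu n, ‖v‖ = 1 → gaussMap K (gradient (suppFn K) v) = v := fun v hv =>
    gaussMap_gradient_suppFn hK h0 hh
      (fun y hy => det_fderiv_dualityMap_ne_zero hK h0 hh hd0 hfc hfpos hfdens hy) hv
  have h1 := (ENNReal.ofReal_le_ofReal_iff (abs_nonneg _)).1
    (ofReal_density_le_abs_det hK hh hd0 hfc hfdens hu)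
  have h2 := (ENNReal.ofReal_le_ofReal_iff hpos.le).1
    (abs_det_le_ofReal_density hK hh hd0 hfc hfdens hgauss hu hne)
  rw [det_fderiv_dualityMap hK h0 hh hu, abs_mul, le_antisymm h2 h1,
    abs_of_pos (pow_pos (suppFn_pos hK h0 (norm_ne_zero_iff.1 (by simp [hu]))) _)]

end Density

section Weight

variable {n : ℕ} {K : Set (Eu n)} {G : ℝ → ℝ}

theorem isCompact_suppFn_preimage_Icc (hK : IsConvexBody K) (h0 : (0 : Eu n) ∈ interior K)
    (a b : ℝ) : IsCompact (suppFn K ⁻¹' Icc a b) := by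
  obtain ⟨C, hC⟩ := exists_lipschitzWith_suppFn hK
  obtain ⟨r, hr, hle⟩ := exists_mul_norm_le_suppFn hK h0
  refine (isCompact_closedBall (0 : Eu n) (b / r)).of_isClosed_subset
    (isClosed_Icc.preimage hC.continuous) fun y hy => ?_
  rw [mem_closedBall_zero_iff, le_div_iff₀' hr]
  exact (hle y).trans hy.2

theorem comp_suppFn_eventuallyEq_zero (hK : IsConvexBody K) {a b : ℝ} (ha : 0 < a)
    (hGs : Function.support G ⊆ Icc a b) : ∀ᶠ y : Eu n in nhds 0, G (suppFn K y) = 0 := by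
  obtain ⟨C, hC⟩ := exists_lipschitzWith_suppFn hK
  have h1 : suppFn K 0 = 0 := by simpa using suppFn_smul hK le_rfl (0 : Eu n)
  have h2 : ∀ᶠ y in nhds (0 : Eu n), suppFn K y < a :=
    hC.continuous.continuousAt.eventually (gt_mem_nhds (by rwa [h1]))
  filter_upwards [h2] with y hy
  by_contra h
  exact (hGs h).1.not_gt hy

theorem hasCompactSupport_comp_suppFn_mul (hK : IsConvexBody K) (h0 : (0 : Eu n) ∈ interior K)
    {a b : ℝ} (hGs : Function.support G ⊆ Icc a b) (ψ : Eu n → ℝ) :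
    HasCompactSupport fun y => G (suppFn K y) * ψ y :=
  HasCompactSupport.of_support_subset_isCompact (isCompact_suppFn_preimage_Icc hK h0 a b)
    fun _ hy => hGs (left_ne_zero_of_mul hy)

theorem contDiff_comp_suppFn_mul (hK : IsConvexBody K)
    (hh : ContDiffOn ℝ 3 (suppFn K) {(0 : Eu n)}ᶜ) (hG : ContDiff ℝ 1 G) {a b : ℝ} (ha : 0 < a)
    (hGs : Function.support G ⊆ Icc a b) {ψ : Eu n → ℝ} (hψ : ContDiffOn ℝ 1 ψ {(0 : Eu n)}ᶜ) :
    ContDiff ℝ 1 fun y => G (suppFn K y) * ψ y := by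
  rw [contDiff_iff_contDiffAt]
  intro y
  rcases eq_or_ne y 0 with rfl | hy
  · refine (contDiffAt_const (c := (0 : ℝ))).congr_of_eventuallyEq ?_
    filter_upwards [comp_suppFn_eventuallyEq_zero hK ha hGs] with z hz
    rw [hz, zero_mul]
  · have hmem := isOpen_compl_singleton.mem_nhds hy
    exact (hG.contDiffAt.comp y ((hh.contDiffAt hmem).of_le (by norm_num))).mul
      (hψ.contDiffAt hmem)

end Weight

section Gauge

variable {n : ℕ} {K : Set (Eu n)} (hK : IsConvexBody K) (h0 : (0 : Eu n) ∈ interior K)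
  (hh : ContDiffOn ℝ 3 (suppFn K) {(0 : Eu n)}ᶜ)
include hK h0 hh

theorem gauge_dualityMap {y : Eu n} (hy : y ≠ 0) : gauge K (dualityMap K y) = suppFn K y := by
  rw [dualityMap, gauge_smul_of_nonneg (suppFn_pos hK h0 hy).le,
    (gauge_eq_one_iff_mem_frontier hK.1 (mem_interior_iff_mem_nhds.1 h0)).2
      (gradient_suppFn_mem_frontier hK hh hy), smul_eq_mul, mul_one]

theorem inner_le_gauge_mul_suppFn (x y : Eu n) : ⟪x, y⟫ ≤ gauge K x * suppFn K y := by
  rcases eq_or_ne x 0 with rfl | hx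
  · simp [gauge_zero]
  obtain ⟨z, hz, rfl⟩ := (image_dualityMap hK h0 hh).ge hx
  rw [gauge_dualityMap hK h0 hh hz, dualityMap, real_inner_smul_left]
  exact mul_le_mul_of_nonneg_left (inner_le_suppFn hK (gradient_suppFn_mem hK
    (fun u hu => differentiableAt_suppFn hh hu) hz) y) (suppFn_pos hK h0 hz).le

omit h0 in
theorem inner_dualityMap_self {y : Eu n} (hy : y ≠ 0) :
    ⟪dualityMap K y, y⟫ = suppFn K y * suppFn K y := by
  rw [dualityMap, real_inner_smul_left, inner_gradient_suppFn_self hK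
    (fun u hu => differentiableAt_suppFn hh hu) hy]

theorem fderiv_gauge_dualityMap {y : Eu n} (hy : y ≠ 0)
    (hd : DifferentiableAt ℝ (gauge K) (dualityMap K y)) (w : Eu n) :
    suppFn K y * fderiv ℝ (gauge K) (dualityMap K y) w = ⟪y, w⟫ := by
  have hmin : IsLocalMin (fun x => suppFn K y * gauge K x - innerSL ℝ y x) (dualityMap K y) :=
    Eventually.of_forall fun x => by
      have h1 := inner_le_gauge_mul_suppFn hK h0 hh x y
      rw [mul_comm] at h1
      simp only [innerSL_apply_apply, real_inner_comm _ y, gauge_dualityMap hK h0 hh hy,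
        inner_dualityMap_self hK hh hy]
      linarith
  have h1 := hmin.hasFDerivAt_eq_zero
    ((hd.hasFDerivAt.const_mul (suppFn K y)).sub (innerSL ℝ y).hasFDerivAt)
  have h2 := congrArg (fun L => L w) (sub_eq_zero.1 h1)
  simpa using h2

theorem fderiv_comp_gauge_dualityMap {G : ℝ → ℝ} (hG : ContDiff ℝ 1 G) {y : Eu n} (hy : y ≠ 0)
    (hd : DifferentiableAt ℝ (gauge K) (dualityMap K y)) (B : Eu n →L[ℝ] Eu n) :
    fderiv ℝ (fun x => G (gauge K x)) (dualityMap K y)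
        (ContinuousLinearMap.adjoint B (dualityMap K y)) =
      fderiv ℝ (fun y => G (suppFn K y)) y (B y) := by
  have hGd : ∀ t, HasDerivAt G (deriv G t) t := fun t =>
    (hG.differentiable (by norm_num) t).hasDerivAt
  have h1 : HasFDerivAt (fun x => G (gauge K x)) _ _ :=
    (hGd _).comp_hasFDerivAt (dualityMap K y) hd.hasFDerivAt
  have h2 : HasFDerivAt (fun y => G (suppFn K y)) _ _ :=
    (hGd _).comp_hasFDerivAt y (differentiableAt_suppFn hh hy).hasFDerivAt
  have h3 := fderiv_gauge_dualityMap hK h0 hh hy hd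
    (ContinuousLinearMap.adjoint B (dualityMap K y))
  rw [ContinuousLinearMap.adjoint_inner_right, dualityMap, inner_smul_right] at h3
  have h4 := mul_left_cancel₀ (suppFn_pos hK h0 hy).ne' h3
  rw [h1.fderiv, h2.fderiv, gauge_dualityMap hK h0 hh hy, smul_apply, smul_apply,
    ← inner_gradient_left (f := suppFn K), real_inner_comm, ← h4]
  rfl

omit hh in
theorem hasCompactSupport_comp_gauge {G : ℝ → ℝ} {a b : ℝ}
    (hGs : Function.support G ⊆ Icc a b) :
    HasCompactSupport fun x => G (gauge K x) := by
  obtain ⟨R, hR0, hR⟩ := hK.2.1.isBounded.subset_closedBall_lt 0 0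
  refine HasCompactSupport.of_support_subset_isCompact
    (isCompact_closedBall (0 : Eu n) (b * R)) fun x hx => ?_
  have h1 := le_gauge_of_subset_closedBall (x := x)
    (absorbent_nhds_zero (mem_interior_iff_mem_nhds.1 h0)) hR0.le hR
  rw [mem_closedBall_zero_iff, ← div_le_iff₀ hR0]
  exact h1.trans (hGs hx).2

end Gauge

section VolumeIdentity

variable {n : ℕ} {K : Set (Eu n)} [Nontrivial (Eu n)] (hK : IsConvexBody K)
  (h0 : (0 : Eu n) ∈ interior K) (hh : ContDiffOn ℝ 3 (suppFn K) {(0 : Eu n)}ᶜ)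
  (hdet : ∀ y : Eu n, y ≠ 0 → (fderiv ℝ (dualityMap K) y).det ≠ 0)
include hK h0 hh hdet

theorem integral_eq_integral_dualityMap (g : Eu n → ℝ) :
    ∫ x, g x = ∫ y, |(fderiv ℝ (dualityMap K) y).det| * g (dualityMap K y) := by
  have h := integral_image_eq_integral_abs_det_fderiv_smul volume (F := ℝ)
    (measurableSet_singleton (0 : Eu n)).compl
    (fun y hy => (hasFDerivAt_dualityMap hh hy).differentiableAt.hasFDerivAt.hasFDerivWithinAt)
    (injOn_dualityMap hK h0 hh hdet) g
  rwa [image_dualityMap hK h0 hh, restrict_compl_singleton] at h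

variable {G : ℝ → ℝ} (hG : ContDiff ℝ 1 G) {a b : ℝ} (ha : 0 < a)
  (hGs : Function.support G ⊆ Icc a b) (B : Eu n →L[ℝ] Eu n)
include hG ha hGs

omit ha in
theorem integral_det_mul_fderiv_comp_suppFn :
    ∫ y, |(fderiv ℝ (dualityMap K) y).det| * fderiv ℝ (fun y => G (suppFn K y)) y (B y) =
      -LinearMap.trace ℝ (Eu n) B.toLinearMap *
        ∫ y, |(fderiv ℝ (dualityMap K) y).det| * G (suppFn K y) := by
  have hinj := injOn_dualityMap hK h0 hh hdet
  have hae : ∀ᵐ y : Eu n, y ≠ 0 := by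
    simp [ae_iff]
  have hG0 : HasCompactSupport G := HasCompactSupport.of_support_subset_isCompact isCompact_Icc hGs
  obtain ⟨C₁, hC₁⟩ := hG.lipschitzWith_of_hasCompactSupport hG0 one_ne_zero
  obtain ⟨C₂, hC₂⟩ := hK.1.lipschitz_gauge (mem_interior_iff_mem_nhds.1 h0)
  have h1 := (hC₁.comp hC₂).integral_fderiv_apply_self (hasCompactSupport_comp_gauge hK h0 hGs)
    (ContinuousLinearMap.adjoint B)
  have h2 : ∫ x, (G ∘ gauge K) x = ∫ y, |(fderiv ℝ (dualityMap K) y).det| * G (suppFn K y) := by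
    rw [integral_eq_integral_dualityMap hK h0 hh hdet]
    refine integral_congr_ae ?_
    filter_upwards [hae] with y hy
    rw [Function.comp_apply, gauge_dualityMap hK h0 hh hy]
  rw [h2, trace_adjoint] at h1
  rw [← h1]
  set g : Eu n → ℝ := fun x => fderiv ℝ (fun y => G (suppFn K y))
    (Function.invFunOn (dualityMap K) {0}ᶜ x) (B (Function.invFunOn (dualityMap K) {0}ᶜ x)) with hg
  have h3 : ∫ x, fderiv ℝ (G ∘ gauge K) x (ContinuousLinearMap.adjoint B x) = ∫ x, g x := by
    refine integral_congr_ae ?_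
    filter_upwards [hC₂.ae_differentiableAt, hae] with x hx hx0
    obtain ⟨y, hy, rfl⟩ := (image_dualityMap hK h0 hh).ge hx0
    simp only [hg]
    rw [hinj.leftInvOn_invFunOn hy]
    exact fderiv_comp_gauge_dualityMap hK h0 hh hG hy hx B
  rw [h3, integral_eq_integral_dualityMap hK h0 hh hdet g]
  refine integral_congr_ae ?_
  filter_upwards [hae] with y hy
  simp only [hg]
  rw [hinj.leftInvOn_invFunOn hy]

theorem integral_comp_suppFn_mul_fderiv {f : Eu n → ℝ} (hf : ContDiffOn ℝ 1 f {(0 : Eu n)}ᶜ)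
    (hfdet : ∀ y : Eu n, y ≠ 0 → |(fderiv ℝ (dualityMap K) y).det| = f y) :
    Integrable (fun y => G (suppFn K y) * fderiv ℝ f y (B y)) ∧
      ∫ y, G (suppFn K y) * fderiv ℝ f y (B y) = 0 := by
  have hae : ∀ᵐ y : Eu n, y ≠ 0 := by
    simp [ae_iff]
  have h1 := integral_det_mul_fderiv_comp_suppFn hK h0 hh hdet hG hGs B
  have hF := contDiff_comp_suppFn_mul hK hh hG ha hGs hf
  have hFc := hasCompactSupport_comp_suppFn_mul hK h0 hGs f
  have hΦ : ContDiff ℝ 1 fun y => G (suppFn K y) := by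
    simpa using contDiff_comp_suppFn_mul hK hh hG ha hGs (contDiffOn_const (c := (1 : ℝ)))
  have hΦc : HasCompactSupport fun y => G (suppFn K y) := by
    simpa using hasCompactSupport_comp_suppFn_mul hK h0 hGs (fun _ => 1)
  obtain ⟨C, hC⟩ := hF.lipschitzWith_of_hasCompactSupport hFc one_ne_zero
  have h2 := hC.integral_fderiv_apply_self hFc B
  have hi1 : Integrable fun y => fderiv ℝ (fun y => G (suppFn K y) * f y) y (B y) := by
    refine Continuous.integrable_of_hasCompactSupport
      ((hF.continuous_fderiv one_ne_zero).clm_apply B.continuous) ?_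
    exact (hFc.fderiv ℝ).mono fun y hy h => hy (by simp [h])
  have hi2 : Integrable fun y => f y * fderiv ℝ (fun y => G (suppFn K y)) y (B y) := by
    have hsupp : HasCompactSupport fun y => f y * fderiv ℝ (fun y => G (suppFn K y)) y (B y) :=
      (hΦc.fderiv ℝ).mono fun y hy h => hy (by simp [h])
    refine Continuous.integrable_of_hasCompactSupport (continuous_iff_continuousAt.2 fun y => ?_)
      hsupp
    rcases eq_or_ne y 0 with rfl | hy
    · refine (continuousAt_const (y := (0 : ℝ))).congr ?_
      filter_upwards [(comp_suppFn_eventuallyEq_zero hK ha hGs).eventually_nhds] with y hy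
      rw [(show (fun y => G (suppFn K y)) =ᶠ[nhds y] fun _ => 0 from hy).fderiv_eq]
      simp
    · exact (hf.continuousOn.continuousAt (isOpen_compl_singleton.mem_nhds hy)).mul
        ((hΦ.continuous_fderiv one_ne_zero).clm_apply B.continuous).continuousAt
  have hprod : (fun y => fderiv ℝ (fun y => G (suppFn K y) * f y) y (B y) -
      f y * fderiv ℝ (fun y => G (suppFn K y)) y (B y)) =ᵐ[volume]
      fun y => G (suppFn K y) * fderiv ℝ f y (B y) := by
    filter_upwards [hae] with y hy
    have h3 : fderiv ℝ (fun y => G (suppFn K y) * f y) y = _ :=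
      ((hΦ.differentiable one_ne_zero y).hasFDerivAt.mul
      ((hf.contDiffAt (isOpen_compl_singleton.mem_nhds hy)).differentiableAt
        one_ne_zero).hasFDerivAt).fderiv
    rw [h3]
    simp
  refine ⟨(hi1.sub hi2).congr hprod, ?_⟩
  have e1 : ∫ y, f y * fderiv ℝ (fun y => G (suppFn K y)) y (B y) =
      ∫ y, |(fderiv ℝ (dualityMap K) y).det| * fderiv ℝ (fun y => G (suppFn K y)) y (B y) := by
    refine integral_congr_ae ?_
    filter_upwards [hae] with y hy
    rw [hfdet y hy]
  have e2 : ∫ y, |(fderiv ℝ (dualityMap K) y).det| * G (suppFn K y) =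
      ∫ y, G (suppFn K y) * f y := by
    refine integral_congr_ae ?_
    filter_upwards [hae] with y hy
    rw [hfdet y hy, mul_comm]
  rw [← integral_congr_ae hprod, integral_sub hi1 hi2, h2, e1, h1, e2, sub_self]

end VolumeIdentity

section Polar

theorem integral_eq_integral_toSphere_integral_Ioi {E : Type*} [NormedAddCommGroup E]
    [NormedSpace ℝ E] [FiniteDimensional ℝ E] [MeasurableSpace E] [BorelSpace E] [Nontrivial E]
    (μ : Measure E) [μ.IsAddHaarMeasure] {q : E → ℝ} (hq : Integrable q μ) :
    ∫ x, q x ∂μ = ∫ u : sphere (0 : E) 1,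
      (∫ r in Ioi (0 : ℝ), r ^ (Module.finrank ℝ E - 1) * q (r • (u : E))) ∂μ.toSphere := by
  set F : sphere (0 : E) 1 × Ioi (0 : ℝ) → ℝ := fun p => q ((p.2 : ℝ) • (p.1 : E)) with hF
  have hcomp : (fun x : ({(0)}ᶜ : Set E) => q x) = F ∘ homeomorphUnitSphereProd E := by
    funext x
    have hx : ‖(x : E)‖ ≠ 0 := norm_ne_zero_iff.2 x.2
    simp [hF, smul_smul, hx]
  have hme := (homeomorphUnitSphereProd E).measurableEmbedding
  have hint : Integrable F (μ.toSphere.prod (.volumeIoiPow (Module.finrank ℝ E - 1))) := by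
    rw [← μ.measurePreserving_homeomorphUnitSphereProd.integrable_comp_emb hme, ← hcomp]
    exact ((integrableOn_iff_comap_subtypeVal (measurableSet_singleton _).compl).1
      hq.integrableOn)
  calc ∫ x, q x ∂μ = ∫ x : ({(0)}ᶜ : Set E), q x ∂(μ.comap (↑)) := by
        rw [integral_subtype_comap (measurableSet_singleton _).compl q, restrict_compl_singleton]
    _ = ∫ p, F p ∂μ.toSphere.prod (.volumeIoiPow (Module.finrank ℝ E - 1)) := by
        rw [← μ.measurePreserving_homeomorphUnitSphereProd.integral_comp hme, hcomp]
        rfl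
    _ = ∫ u, ∫ r, F (u, r) ∂(.volumeIoiPow (Module.finrank ℝ E - 1)) ∂μ.toSphere :=
        integral_prod _ hint
    _ = _ := by
        refine integral_congr_ae (Eventually.of_forall fun u => ?_)
        simp only [Measure.volumeIoiPow, ENNReal.ofReal, hF]
        rw [integral_withDensity_eq_integral_smul,
          integral_subtype_comap measurableSet_Ioi
            fun a => Real.toNNReal (a ^ (Module.finrank ℝ E - 1)) • q (a • (u : E)),
          setIntegral_congr_fun measurableSet_Ioi fun x hx => ?_]
        · rw [NNReal.smul_def, Real.coe_toNNReal _ (pow_nonneg hx.out.le _), smul_eq_mul]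
        · exact (measurable_subtype_coe.pow_const _).real_toNNReal

theorem integral_Ioi_pow_mul_comp_mul_right (m : ℕ) (G : ℝ → ℝ) {c : ℝ} (hc : 0 < c) :
    ∫ r in Ioi (0 : ℝ), r ^ m * G (r * c) =
      (c ^ (m + 1))⁻¹ * ∫ s in Ioi (0 : ℝ), s ^ m * G s := by
  have h := integral_comp_mul_right_Ioi (fun s => s ^ m * G s) 0 hc
  rw [zero_mul, smul_eq_mul] at h
  rw [pow_succ, mul_inv, mul_assoc, ← h, ← integral_const_mul]
  refine integral_congr_ae (Eventually.of_forall fun r => ?_)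
  simp only [mul_pow]
  field_simp

theorem fderiv_apply_smul_of_forall_smul_eq {E : Type*} [NormedAddCommGroup E] [NormedSpace ℝ E]
    {f : E → ℝ} (hf : ∀ c : ℝ, 0 < c → ∀ x, f (c • x) = f x) {c : ℝ} (hc : 0 < c) (x v : E) :
    fderiv ℝ f (c • x) (c • v) = fderiv ℝ f x v := by
  have h := fderiv_comp_smul (𝕜 := ℝ) (f := f) (x := x) c
  rw [funext (hf c hc)] at h
  rw [h, map_smul]
  rfl

theorem integral_Ioi_pow_mul_pos (m : ℕ) (G : ContDiffBump (2 : ℝ)) (hG : G.rOut ≤ 1) :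
    0 < ∫ s in Ioi (0 : ℝ), s ^ m * G s := by
  have hint : Integrable fun s : ℝ => s ^ m * G s :=
    Continuous.integrable_of_hasCompactSupport ((continuous_id.pow m).mul G.continuous)
      G.hasCompactSupport.mul_left
  rw [setIntegral_pos_iff_support_of_nonneg_ae _ hint.integrableOn]
  · refine (measure_ball_pos volume (2 : ℝ) G.rOut_pos).trans_le (measure_mono fun s hs => ?_)
    have hs0 : 0 < s := by
      rw [Real.ball_eq_Ioo] at hs
      linarith [hs.1]
    exact ⟨mul_ne_zero (pow_pos hs0 m).ne' (G.pos_of_mem_ball hs).ne', hs0⟩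
  · filter_upwards [ae_restrict_mem measurableSet_Ioi] with s hs
    exact mul_nonneg (pow_nonneg (le_of_lt hs) m) G.nonneg

end Polar

section Sphere

variable {n : ℕ} {K : Set (Eu n)} (hK : IsConvexBody K) (h0 : (0 : Eu n) ∈ interior K)
include hK h0

/-- Sections of an integrable function `G (suppFn K y) * Q y` with `Q` homogeneous of degree `0`
along rays. -/
theorem integral_comp_suppFn_mul_eq [Nontrivial (Eu n)] {G : ℝ → ℝ} {Q : Eu n → ℝ}
    (hQ : ∀ c : ℝ, 0 < c → ∀ x, Q (c • x) = Q x)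
    (hi : Integrable fun y => G (suppFn K y) * Q y) :
    ∫ y, G (suppFn K y) * Q y = (∫ s in Ioi (0 : ℝ), s ^ (n - 1) * G s) *
      ∫ u : sphere (0 : Eu n) 1, (suppFn K u ^ n)⁻¹ * Q u ∂(volume : Measure (Eu n)).toSphere := by
  have hn : n - 1 + 1 = n := by
    have := Module.finrank_pos (R := ℝ) (M := Eu n)
    rw [finrank_euclideanSpace_fin] at this
    omega
  rw [integral_eq_integral_toSphere_integral_Ioi volume hi, ← integral_const_mul,
    finrank_euclideanSpace_fin]
  refine integral_congr_ae (Eventually.of_forall fun u => ?_)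
  have hu : (u : Eu n) ≠ 0 := ne_zero_of_mem_unit_sphere u
  have h1 := integral_Ioi_pow_mul_comp_mul_right (n - 1) G (suppFn_pos hK h0 hu)
  rw [hn] at h1
  simp only
  rw [← mul_assoc, mul_comm (∫ s in Ioi (0 : ℝ), _), ← h1, ← integral_mul_const]
  refine setIntegral_congr_fun measurableSet_Ioi fun r hr => ?_
  beta_reduce
  rw [hQ r hr, suppFn_smul hK (le_of_lt hr), mul_assoc]

theorem integral_toSphere_fderiv_eq_zero [Nontrivial (Eu n)]
    (hh : ContDiffOn ℝ 3 (suppFn K) {(0 : Eu n)}ᶜ)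
    (hdet : ∀ y : Eu n, y ≠ 0 → (fderiv ℝ (dualityMap K) y).det ≠ 0) (B : Eu n →L[ℝ] Eu n)
    {f : Eu n → ℝ} (hf : ContDiffOn ℝ 1 f {(0 : Eu n)}ᶜ)
    (hfdet : ∀ y : Eu n, y ≠ 0 → |(fderiv ℝ (dualityMap K) y).det| = f y)
    (hfh : ∀ c : ℝ, 0 < c → ∀ x, f (c • x) = f x) :
    ∫ u : sphere (0 : Eu n) 1, (suppFn K u ^ n)⁻¹ * fderiv ℝ f u (B u)
      ∂(volume : Measure (Eu n)).toSphere = 0 := by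
  set G : ContDiffBump (2 : ℝ) := ⟨1 / 2, 1, by norm_num, by norm_num⟩ with hG
  have hGs : Function.support G ⊆ Icc 1 3 := by
    rw [G.support_eq, Real.ball_eq_Ioo]
    refine Ioo_subset_Icc_self.trans (Icc_subset_Icc ?_ ?_) <;> norm_num [hG]
  obtain ⟨hi, h⟩ := integral_comp_suppFn_mul_fderiv hK h0 hh hdet G.contDiff one_pos hGs B hf hfdet
  rw [integral_comp_suppFn_mul_eq hK h0 (fun c hc x => by
    rw [map_smul, fderiv_apply_smul_of_forall_smul_eq hfh hc]) hi] at h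
  exact (mul_eq_zero.1 h).resolve_left (integral_Ioi_pow_mul_pos _ G le_rfl).ne'

theorem integrable_toSphere_fderiv (hh : ContDiffOn ℝ 3 (suppFn K) {(0 : Eu n)}ᶜ)
    (B : Eu n →L[ℝ] Eu n) {f : Eu n → ℝ} (hf : ContDiffOn ℝ 1 f {(0 : Eu n)}ᶜ) :
    Integrable (fun u : sphere (0 : Eu n) 1 => (suppFn K u ^ n)⁻¹ * fderiv ℝ f u (B u))
      (volume : Measure (Eu n)).toSphere := by
  have hc : ContinuousOn (fun y : Eu n => (suppFn K y ^ n)⁻¹ * fderiv ℝ f y (B y)) {0}ᶜ :=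
    ((hh.continuousOn.pow n).inv₀ fun y hy => (pow_pos (suppFn_pos hK h0 hy) n).ne').mul
      ((hf.continuousOn_fderiv_of_isOpen isOpen_compl_singleton le_rfl).clm_apply
        B.continuous.continuousOn)
  have hc' : Continuous fun u : sphere (0 : Eu n) 1 =>
      (suppFn K u ^ n)⁻¹ * fderiv ℝ f u (B u) :=
    hc.comp_continuous continuous_subtype_val fun u => ne_zero_of_mem_unit_sphere u
  exact hc'.integrable_of_hasCompactSupport (HasCompactSupport.of_compactSpace _)

theorem contDiffOn_suppFn_rpow_mul (hh : ContDiffOn ℝ 3 (suppFn K) {(0 : Eu n)}ᶜ)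
    {ftil : Eu n → ℝ} (hf : ContDiffOn ℝ 1 ftil {(0 : Eu n)}ᶜ) (p : ℝ) :
    ContDiffOn ℝ 1 (fun x => suppFn K x ^ p * ftil x) {(0 : Eu n)}ᶜ :=
  ((hh.of_le (by norm_num)).rpow_const_of_ne fun _ hy => (suppFn_pos hK h0 hy).ne').mul hf

theorem suppFn_rpow_mul_smul {ftil : Eu n → ℝ} {p : ℝ}
    (hf : ∀ c : ℝ, 0 < c → ∀ x : Eu n, ftil (c • x) = c ^ (-p) * ftil x) {c : ℝ} (hc : 0 < c)
    (x : Eu n) : suppFn K (c • x) ^ p * ftil (c • x) = suppFn K x ^ p * ftil x := by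
  rcases eq_or_ne x 0 with rfl | hx
  · rw [smul_zero]
  rw [hf c hc, suppFn_smul hK hc.le, Real.mul_rpow hc.le (suppFn_pos hK h0 hx).le,
    Real.rpow_neg hc.le]
  have := (Real.rpow_pos_of_pos hc p).ne'
  field_simp

end Sphere

theorem sum_sum_mul_apply_single {n : ℕ} (A : Matrix (Fin n) (Fin n) ℝ) (u : Eu n)
    (L : Eu n →L[ℝ] ℝ) : ∑ i, ∑ j, u j * A i j * L (EuclideanSpace.single i 1) =
      L (Matrix.toEuclideanCLM (n := Fin n) (𝕜 := ℝ) A u) := by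
  conv_rhs => rw [← (EuclideanSpace.basisFun (Fin n) ℝ).sum_repr
    (Matrix.toEuclideanCLM (n := Fin n) (𝕜 := ℝ) A u)]
  rw [map_sum]
  refine Finset.sum_congr rfl fun i _ => ?_
  simp only [map_smul, EuclideanSpace.basisFun_apply, EuclideanSpace.basisFun_repr,
    Matrix.ofLp_toEuclideanCLM, Matrix.mulVec, dotProduct, smul_eq_mul, Finset.sum_mul]
  exact Finset.sum_congr rfl fun j _ => by ring

/-- Chou–Wang, Proposition 1.7: if `K` has `C³₊` boundary with support
function `h = suppFn K` (of class `C³` away from the origin) and curvature function `f̃`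
(the `(-n-1)`-homogeneous extension of `1/κ`, the density of the surface area measure),
then for the `0`-homogeneous extension `f = h^{n+1} f̃` of the density of `dS_{K,-n}` and
any projective vector field `𝒱(ξ) = ξ_j A^{ij} ∂_i` with `A ∈ GL(n)`, one has
`∫_{S^{n-1}} h^{-n} 𝒱f dH^{n-1} = 0`. -/
theorem critical_case_projective_invariance
    (n : ℕ) (K : Set (Eu n)) (hK : IsConvexBody K) (h0 : (0 : Eu n) ∈ interior K)
    (ftil : Eu n → ℝ)
    (hh3 : ContDiffOn ℝ 3 (suppFn K) {(0 : Eu n)}ᶜ)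
    (hf1 : ContDiffOn ℝ 1 ftil {(0 : Eu n)}ᶜ)
    (hfpos : ∀ u ∈ sphere (0 : Eu n) 1, 0 < ftil u)
    (hfhom : ∀ c : ℝ, 0 < c → ∀ x : Eu n, ftil (c • x) = c ^ (-(n : ℝ) - 1) * ftil x)
    (hfdens : ∀ ω : Set (Eu n), MeasurableSet ω →
      μH[(n:ℝ) - 1] {x ∈ frontier K | gaussMap K x ∈ ω} =
        ∫⁻ u in ω ∩ sphere (0 : Eu n) 1, ENNReal.ofReal (ftil u) ∂(μH[(n:ℝ) - 1]))
    (f : Eu n → ℝ) (hf : f = fun x => suppFn K x ^ ((n : ℝ) + 1) * ftil x)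
    (A : Matrix (Fin n) (Fin n) ℝ) (hA : IsUnit A.det) :
    ∫ u in sphere (0 : Eu n) 1,
        suppFn K u ^ (-(n : ℝ)) *
          (∑ i, ∑ j, u j * A i j * fderiv ℝ f u (EuclideanSpace.single i 1))
        ∂(μH[(n:ℝ) - 1]) = 0 := by
  rcases Nat.eq_zero_or_pos n with rfl | hn
  · simp
  have : Nonempty (Fin n) := ⟨⟨0, hn⟩⟩
  have hn1 : (1 : ℝ) ≤ n := by exact_mod_cast hn
  have hd0 : (0 : ℝ) ≤ (n : ℝ) - 1 := by linarith
  have hfc : ContinuousOn ftil (sphere (0 : Eu n) 1) := hf1.continuousOn.mono fun u hu h =>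
    ne_zero_of_mem_unit_sphere ⟨u, hu⟩ h
  have hdet : ∀ y : Eu n, y ≠ 0 → (fderiv ℝ (dualityMap K) y).det ≠ 0 := fun y hy =>
    det_fderiv_dualityMap_ne_zero hK h0 hh3 hd0 hfc hfpos hfdens hy
  have hfC : ContDiffOn ℝ 1 f {(0 : Eu n)}ᶜ := hf ▸ contDiffOn_suppFn_rpow_mul hK h0 hh3 hf1 _
  have hfh : ∀ c : ℝ, 0 < c → ∀ x, f (c • x) = f x := fun c hc x => by
    rw [hf]
    exact suppFn_rpow_mul_smul hK h0
      (fun c hc x => by rw [hfhom c hc, neg_add, ← sub_eq_add_neg]) hc x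
  have hfdet : ∀ y : Eu n, y ≠ 0 → |(fderiv ℝ (dualityMap K) y).det| = f y := fun y hy => by
    have hc : 0 < ‖y‖⁻¹ := inv_pos.2 (norm_pos_iff.2 hy)
    rw [← fderiv_dualityMap_smul hK hh3 hc, ← hfh _ hc,
      abs_det_fderiv_dualityMap_of_norm_eq_one hK h0 hh3 hd0 hfc hfpos hfdens
        (by simp [norm_smul, hy]), hf]
    simp only
    norm_cast
  set B := Matrix.toEuclideanCLM (n := Fin n) (𝕜 := ℝ) A
  have hd : (n : ℝ) - 1 + 1 = Module.finrank ℝ (Eu n) := by simp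
  refine Eq.trans (integral_congr_ae (Eventually.of_forall fun u => ?_))
    (integral_hausdorffMeasure_sphere_eq_zero
      (q := fun u => (suppFn K u ^ n)⁻¹ * fderiv ℝ f u (B u)) hd0 hd (integrable_toSphere_fderiv hK h0 hh3 B hfC)
      (integral_toSphere_fderiv_eq_zero hK h0 hh3 hdet B hfC hfdet hfh))
  simp only
  rw [sum_sum_mul_apply_single, ← Int.cast_natCast, ← Int.cast_neg, Real.rpow_intCast, zpow_neg,
    zpow_natCast]

end
end

section
/- Let ε ∈ (0, 1/3], R ≥ 1, q ≥ n-1, let K ∈ K_0^n with o ∈ ∂K and diam K ≤ R, and let v be an exterior unit normal vector to K at o. Set α = arcsin(ε/(2R)). Then: (i) if ξ ∈ int K with ‖ξ‖ < ε/2 and u ∈ Ω(v,α), then h_K(u) − ⟨ξ,u⟩ < ε; (ii) if δ ∈ (0, sin α) and ξ ∈ int K with ‖ξ‖ ≤ Rδ, then ∫_{Ω(v,α)} (h_K(u) − ⟨ξ,u⟩)^{−q} dH^{n-1}(u) ≥ ((n−2) κ_{n−2} / (2^q R^q)) · log(sin α / δ). -/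
open MeasureTheory Metric Set Filter
open scoped ENNReal RealInnerProductSpace NNReal

noncomputable section

/-- The geodesic ball `Ω(v, α)` on the sphere: unit vectors within angle `α` of `v`. -/
def geodBall {n : ℕ} (v : Eu n) (α : ℝ) : Set (Eu n) :=
  {u ∈ sphere (0 : Eu n) 1 | InnerProductGeometry.angle u v ≤ α}

/-- The volume of the Euclidean unit ball of dimension `m ≥ 1`. -/
theorem toReal_volume_unitBall (m : ℕ) :
    (volume (ball (0 : Eu (m + 1)) 1)).toReal =
      √Real.pi ^ (m + 1) / Real.Gamma ((m + 1 : ℝ) / 2 + 1) := by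
  rw [EuclideanSpace.volume_ball]
  have h : 0 < Real.Gamma ((m + 1 : ℝ) / 2 + 1) := Real.Gamma_pos_of_pos (by positivity)
  simp only [ENNReal.ofReal_one, one_pow, one_mul, Fintype.card_fin, Nat.cast_add, Nat.cast_one]
  exact ENNReal.toReal_ofReal (by positivity)

theorem volume_unitBall_recursion (m : ℕ) :
    (volume (ball (0 : Eu (m + 3)) 1)).toReal =
      2 * Real.pi / (m + 3) * (volume (ball (0 : Eu (m + 1)) 1)).toReal := by
  rw [toReal_volume_unitBall (m + 2), toReal_volume_unitBall m]
  have e : (((m + 2 : ℕ) : ℝ) + 1) / 2 + 1 = ((m + 1 : ℝ) / 2 + 1) + 1 := by push_cast; ring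
  have hp : (0 : ℝ) < (m + 1 : ℝ) / 2 + 1 := by positivity
  have h : 0 < Real.Gamma ((m + 1 : ℝ) / 2 + 1) := Real.Gamma_pos_of_pos hp
  rw [e, Real.Gamma_add_one hp.ne', show m + 2 + 1 = (m + 1) + 2 by ring, pow_add,
    Real.sq_sqrt Real.pi_pos.le]
  have : (m : ℝ) + 3 ≠ 0 := by positivity
  field_simp
  ring

theorem volume_unitBall_le_of_twelve_le (m : ℕ) (hm : 11 ≤ m) :
    (volume (ball (0 : Eu (m + 1)) 1)).toReal ≤ 3 / 2 := by
  have hπ : Real.pi < 3.15 := Real.pi_lt_d2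
  have hπ0 := Real.pi_pos
  induction m using Nat.strong_induction_on with
  | _ m ih =>
    rcases Nat.lt_or_ge m 13 with h | h
    · obtain rfl | rfl : m = 11 ∨ m = 12 := by omega
      · rw [InnerProductSpace.volume_ball_of_dim_even (k := 6) (by simp)]
        simp only [ENNReal.ofReal_one, one_pow, one_mul]
        rw [ENNReal.toReal_ofReal (by positivity)]
        have : Real.pi ^ 6 ≤ 3.15 ^ 6 := by gcongr
        norm_num [Nat.factorial] at this ⊢
        linarith
      · rw [InnerProductSpace.volume_ball_of_dim_odd (k := 6) (by simp)]
        simp only [ENNReal.ofReal_one, one_pow, one_mul]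
        rw [ENNReal.toReal_ofReal (by positivity)]
        have : Real.pi ^ 6 ≤ 3.15 ^ 6 := by gcongr
        norm_num [Nat.doubleFactorial] at this ⊢
        linarith
    · obtain ⟨k, rfl⟩ : ∃ k, m = k + 2 := ⟨m - 2, by omega⟩
      have := ih k (by omega) (by omega)
      rw [volume_unitBall_recursion k]
      have hk : (11 : ℝ) ≤ k := by exact_mod_cast (by omega : 11 ≤ k)
      have h1 : 2 * Real.pi / (k + 3) ≤ 1 := by
        rw [div_le_one (by positivity)]; linarith
      calc _ ≤ 1 * (volume (ball (0 : Eu (k + 1)) 1)).toReal := by gcongr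
        _ ≤ 3 / 2 := by linarith

theorem volume_unitBall_le_succ (m : ℕ) (hm : m ≤ 10) :
    (volume (ball (0 : Eu (m + 1)) 1)).toReal ≤
      3 / 2 * (volume (ball (0 : Eu (m + 2)) 1)).toReal := by
  rw [toReal_volume_unitBall m, toReal_volume_unitBall (m + 1)]
  set x : ℝ := (m + 1 : ℝ) / 2 + 1 with hx
  have hx1 : 1 < x := by rw [hx]; linarith [show (0 : ℝ) ≤ m by positivity]
  have hm' : (m : ℝ) ≤ 10 := by exact_mod_cast hm
  have e : (((m + 1 : ℕ) : ℝ) + 1) / 2 + 1 = x + 1 / 2 := by rw [hx]; push_cast; ring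
  rw [e]
  have G0 : 0 < Real.Gamma x := Real.Gamma_pos_of_pos (by linarith)
  have G1 : 0 < Real.Gamma (x + 1 / 2) := Real.Gamma_pos_of_pos (by linarith)
  have key : Real.Gamma (x + 1 / 2) ≤ √x * Real.Gamma x := by
    have := Real.Gamma_mul_add_mul_le_rpow_Gamma_mul_rpow_Gamma (s := x) (t := x + 1)
      (a := 1 / 2) (b := 1 / 2) (by linarith) (by linarith) (by norm_num) (by norm_num)
      (by norm_num)
    rw [show 1 / 2 * x + 1 / 2 * (x + 1) = x + 1 / 2 by ring,
      Real.Gamma_add_one (s := x) (zero_lt_one.trans hx1).ne',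
      ← Real.sqrt_eq_rpow, ← Real.sqrt_eq_rpow,
      Real.sqrt_mul (by linarith)] at this
    calc _ ≤ _ := this
      _ = √x * (√(Real.Gamma x) * √(Real.Gamma x)) := by ring
      _ = _ := by rw [Real.mul_self_sqrt G0.le]
  have hs : √x ≤ 3 / 2 * √Real.pi := by
    rw [← Real.sqrt_sq (show (0 : ℝ) ≤ 3 / 2 by norm_num), ← Real.sqrt_mul (by positivity)]
    apply Real.sqrt_le_sqrt
    have := Real.pi_gt_d2
    rw [hx]; linarith
  rw [pow_succ √Real.pi (m + 1), div_le_iff₀ G0]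
  have : Real.Gamma (x + 1 / 2) ≤ 3 / 2 * √Real.pi * Real.Gamma x := key.trans (by gcongr)
  calc √Real.pi ^ (m + 1)
      = √Real.pi ^ (m + 1) * (Real.Gamma (x + 1 / 2) / Real.Gamma (x + 1 / 2)) := by
        rw [div_self G1.ne', mul_one]
    _ ≤ √Real.pi ^ (m + 1) * (3 / 2 * √Real.pi * Real.Gamma x / Real.Gamma (x + 1 / 2)) := by gcongr
    _ = _ := by ring

theorem volume_le_hausdorffMeasure (d : ℕ) :
    (volume : Measure (Eu d)) ≤ μH[d] := by
  refine Measure.le_hausdorffMeasure (d : ℝ) _ 1 one_pos fun s _ => ?_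
  have h := Real.volume_pi_le_diam_pow (WithLp.ofLp '' s)
  have h1 : volume s = volume (WithLp.ofLp '' s) := by
    have := ((EuclideanSpace.volume_preserving_symm_measurableEquiv_toLp (Fin d)).symm
      (MeasurableEquiv.toLp 2 (Fin d → ℝ)).symm).measure_preimage_equiv s
    rw [← this]
    congr 1
    ext x
    exact ⟨fun h => ⟨_, h, rfl⟩, fun ⟨y, hy, h⟩ => h ▸ hy⟩
  rw [h1]
  refine h.trans ?_
  have := (PiLp.lipschitzWith_ofLp 2 (fun _ : Fin d => ℝ)).ediam_image_le s
  simp only [Fintype.card_fin, ENNReal.rpow_natCast]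
  gcongr
  simpa using this

theorem inv_volume_unitBall_smul_le_hausdorffMeasure (d : ℕ) :
    (volume (ball (0 : Eu d) 1))⁻¹ • (volume : Measure (Eu d)) ≤ μH[d] := by
  refine Measure.le_hausdorffMeasure (d : ℝ) _ 1 one_pos fun s hs => ?_
  rcases s.eq_empty_or_nonempty with rfl | ⟨x, hx⟩
  · simp
  have hfin : ediam s ≠ ⊤ := (hs.trans_lt ENNReal.one_lt_top).ne
  have hsub : s ⊆ closedBall x (diam s) := fun y hy => by
    have hb : Bornology.IsBounded s := Metric.isBounded_iff_ediam_ne_top.2 hfin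
    exact dist_le_diam_of_mem hb hy hx
  have h0 : volume (ball (0 : Eu d) 1) ≠ 0 := (measure_ball_pos _ _ one_pos).ne'
  have h1 : volume (ball (0 : Eu d) 1) ≠ ⊤ := measure_ball_lt_top.ne
  rw [Measure.smul_apply, smul_eq_mul]
  calc _ ≤ (volume (ball (0 : Eu d) 1))⁻¹ * volume (closedBall x (diam s)) := by gcongr
    _ = ENNReal.ofReal (diam s) ^ d := by
      rw [Measure.addHaar_closedBall _ _ diam_nonneg, finrank_euclideanSpace_fin,
        ENNReal.ofReal_pow diam_nonneg, mul_comm, mul_assoc, ENNReal.mul_inv_cancel h0 h1, mul_one]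
    _ = _ := by rw [diam, ENNReal.ofReal_toReal hfin, ENNReal.rpow_natCast]

/-- On a Euclidean space of dimension `k + 2`, the Hausdorff measure dominates a multiple of the
volume which gives the unit ball at least `2 / 3` of the volume of the unit ball one dimension
below. -/
theorem exists_smul_volume_le_hausdorffMeasure (k : ℕ) :
    ∃ c : ℝ, 0 ≤ c ∧ ENNReal.ofReal c • (volume : Measure (Eu (k + 2))) ≤ μH[(k + 2 : ℕ)] ∧
      (volume (ball (0 : Eu (k + 1)) 1)).toReal ≤
        3 / 2 * (c * (volume (ball (0 : Eu (k + 2)) 1)).toReal) := by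
  rcases Nat.lt_or_ge k 11 with h | h
  · exact ⟨1, zero_le_one, by simpa using volume_le_hausdorffMeasure (k + 2),
      by simpa using volume_unitBall_le_succ k (by omega)⟩
  · have h0 : volume (ball (0 : Eu (k + 2)) 1) ≠ 0 := (measure_ball_pos _ _ one_pos).ne'
    have h1 : volume (ball (0 : Eu (k + 2)) 1) ≠ ⊤ := measure_ball_lt_top.ne
    refine ⟨(volume (ball (0 : Eu (k + 2)) 1))⁻¹.toReal, ENNReal.toReal_nonneg, ?_, ?_⟩
    · rw [ENNReal.ofReal_toReal (ENNReal.inv_ne_top.2 h0)]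
      exact inv_volume_unitBall_smul_le_hausdorffMeasure (k + 2)
    · rw [← ENNReal.toReal_mul, ENNReal.inv_mul_cancel h0 h1]
      simpa using volume_unitBall_le_of_twelve_le k h

theorem continuousOn_radialDensity (k : ℕ) {δ : ℝ} (hδ : 0 < δ) :
    ContinuousOn (fun r : ℝ => r ^ (k + 1) * (2 / (r + δ)) ^ (k + 2)) (Ici 0) := by
  refine (continuousOn_pow _).mul ((continuousOn_const.div (by fun_prop) fun r hr => ?_).pow _)
  have : (0 : ℝ) ≤ r := hr
  positivity

theorem inv_mul_le_radialDensity (k : ℕ) {δ r : ℝ} (hδ : 0 < δ) (hr : 0 < r) :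
    (1 + (k + 2) * ((r - δ) / (r + δ))) * r⁻¹ ≤ r ^ (k + 1) * (2 / (r + δ)) ^ (k + 2) := by
  have h1 : -1 ≤ (r - δ) / (r + δ) := by rw [le_div_iff₀ (by positivity)]; linarith
  have h := one_add_mul_le_pow (show -2 ≤ (r - δ) / (r + δ) by linarith) (k + 2)
  have e : 1 + (r - δ) / (r + δ) = r * (2 / (r + δ)) := by
    have : r + δ ≠ 0 := by positivity
    field_simp
    ring
  rw [e, mul_pow] at h
  push_cast at h
  calc _ ≤ (r ^ (k + 2) * (2 / (r + δ)) ^ (k + 2)) * r⁻¹ := by gcongr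
    _ = _ := by rw [pow_succ r (k + 1)]; field_simp

/-- The radial integral grows at least like `3 / 2 * log`. -/
theorem log_le_integral_radialDensity (k : ℕ) {δ s : ℝ} (hδ : 0 < δ) (hs : δ < s) :
    3 / 2 * Real.log (s / δ) ≤ ∫ r in (0 : ℝ)..s, r ^ (k + 1) * (2 / (r + δ)) ^ (k + 2) := by
  set f : ℝ → ℝ := fun r => r ^ (k + 1) * (2 / (r + δ)) ^ (k + 2) with hf
  have hfi : ∀ a b : ℝ, 0 ≤ a → 0 ≤ b → IntervalIntegrable f volume a b := fun a b ha hb =>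
    ((continuousOn_radialDensity k hδ).mono fun x hx =>
      (le_min ha hb).trans hx.1).intervalIntegrable
  have hinv : ∀ a b c : ℝ, 0 < a → 0 < b →
      IntervalIntegrable (fun x => c * x⁻¹) volume a b := fun a b c ha hb =>
    (continuousOn_const.mul (continuousOn_inv₀.mono fun x hx => by
      have : 0 < x := (lt_min ha hb).trans_le hx.1
      exact this.ne')).intervalIntegrable
  have hlow : ∀ a b c : ℝ, 0 < a → a ≤ b → (∀ r, a ≤ r → c ≤ 1 + (k + 2) * ((r - δ) / (r + δ))) →
      c * Real.log (b / a) ≤ ∫ r in a..b, f r := by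
    intro a b c ha hab hc
    rw [← integral_inv_of_pos ha (ha.trans_le hab), ← intervalIntegral.integral_const_mul]
    refine intervalIntegral.integral_mono_on hab (hinv a b c ha (ha.trans_le hab))
      (hfi a b ha.le (ha.le.trans hab)) fun r hr => ?_
    have hr0 : 0 < r := ha.trans_le hr.1
    exact (mul_le_mul_of_nonneg_right (hc r hr.1) (by positivity)).trans
      (inv_mul_le_radialDensity k hδ hr0)
  have hk : (0 : ℝ) ≤ k := k.cast_nonneg
  have hcore : 1 / ((k : ℝ) + 2) ≤ ∫ r in (0 : ℝ)..δ, f r := by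
    have e : ∫ r in (0 : ℝ)..δ, r ^ (k + 1) * (1 / δ) ^ (k + 2) = 1 / ((k : ℝ) + 2) := by
      rw [intervalIntegral.integral_mul_const, integral_pow]
      push_cast
      rw [zero_pow (by omega), show (k : ℝ) + 1 + 1 = k + 2 by ring, one_div_pow]
      field_simp
      ring
    rw [← e]
    refine intervalIntegral.integral_mono_on hδ.le (Continuous.intervalIntegrable (by fun_prop) _ _)
      (hfi 0 δ le_rfl hδ.le) fun r hr => ?_
    have hr0 : 0 ≤ r := hr.1
    have hrδ : r ≤ δ := hr.2
    have : 1 / δ ≤ 2 / (r + δ) := by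
      rw [div_le_div_iff₀ hδ (by positivity)]; linarith
    simp only [hf]
    gcongr
  have hone : ∀ r, δ ≤ r → (1 : ℝ) ≤ 1 + (k + 2) * ((r - δ) / (r + δ)) := fun r hr => by
    have : 0 ≤ (r - δ) / (r + δ) := div_nonneg (by linarith) (by linarith)
    have := mul_nonneg (show (0 : ℝ) ≤ k + 2 by positivity) this
    linarith
  set T : ℝ := (2 * k + 5) / (2 * k + 3) with hT
  have hT1 : T - 1 = 2 / (2 * k + 3) := by rw [hT]; field_simp; ring
  have hT0 : 0 < T := by positivity
  have hTlog : Real.log T ≤ 2 / (k + 2) := by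
    have := Real.log_le_sub_one_of_pos hT0
    have h2 : (2 : ℝ) / (2 * k + 3) ≤ 2 / (k + 2) := by gcongr <;> linarith
    linarith
  have hhalf : 2 / ((k : ℝ) + 2) = 2 * (1 / (k + 2)) := by ring
  rcases le_or_gt s (δ * T) with h | h
  · have hlog : Real.log (s / δ) ≤ Real.log T :=
      Real.log_le_log (div_pos (hδ.trans hs) hδ) (by rw [div_le_iff₀ hδ]; linarith)
    have := hlow δ s 1 hδ hs.le hone
    rw [← intervalIntegral.integral_add_adjacent_intervals (hfi 0 δ le_rfl hδ.le)
      (hfi δ s hδ.le (hδ.trans hs).le)]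
    linarith
  · have hTδ : δ ≤ δ * T := by
      have : 0 < 2 / (2 * (k : ℝ) + 3) := by positivity
      nlinarith
    have hTδ0 : 0 < δ * T := by positivity
    have h1 := hlow δ (δ * T) 1 hδ hTδ hone
    have h2 := hlow (δ * T) s (3 / 2) hTδ0 h.le fun r hr => by
      have : 1 / (2 * ((k : ℝ) + 2)) ≤ (r - δ) / (r + δ) := by
        rw [div_le_div_iff₀ (by positivity) (by linarith)]
        have : δ * (2 * k + 5) ≤ r * (2 * k + 3) := by
          rwa [hT, ← mul_div_assoc, div_le_iff₀ (by positivity)] at hr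
        linarith
      have := mul_le_mul_of_nonneg_left this (show (0 : ℝ) ≤ k + 2 by positivity)
      have e : ((k : ℝ) + 2) * (1 / (2 * ((k : ℝ) + 2))) = 1 / 2 := by field_simp
      linarith
    rw [← intervalIntegral.integral_add_adjacent_intervals (hfi 0 δ le_rfl hδ.le)
      (hfi δ s hδ.le (hδ.trans hs).le),
      ← intervalIntegral.integral_add_adjacent_intervals (hfi δ (δ * T) hδ.le hTδ0.le)
      (hfi (δ * T) s hTδ0.le (hδ.trans hs).le)]
    have e1 : δ * T / δ = T := by field_simp
    have e2 : Real.log (s / (δ * T)) = Real.log (s / δ) - Real.log T := by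
      rw [← Real.log_div (div_pos (hδ.trans hs) hδ).ne' hT0.ne', div_div]
    rw [e1] at h1
    rw [e2] at h2
    linarith

/-- Polar coordinates for the radial density on a closed ball. -/
theorem log_le_lintegral_closedBall (k : ℕ) {δ s : ℝ} (hδ : 0 < δ) (hs : δ < s) :
    ENNReal.ofReal ((k + 2) * (volume (ball (0 : Eu (k + 2)) 1)).toReal *
        (3 / 2 * Real.log (s / δ))) ≤
      ∫⁻ y in closedBall (0 : Eu (k + 2)) s, ENNReal.ofReal ((2 / (‖y‖ + δ)) ^ (k + 2)) := by
  have hs0 : 0 < s := hδ.trans hs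
  set g : ℝ → ℝ := fun r => (2 / (r + δ)) ^ (k + 2) with hg
  have hcont : ContinuousOn (fun y : Eu (k + 2) => g ‖y‖) (closedBall 0 s) := by
    refine (ContinuousOn.div continuousOn_const (by fun_prop) fun y _ => ?_).pow _
    positivity
  have hpos : ∀ y : Eu (k + 2), 0 ≤ g ‖y‖ := fun y => by simp only [hg]; positivity
  rw [← ofReal_integral_eq_lintegral_ofReal
    (hcont.integrableOn_compact (isCompact_closedBall _ _)) (ae_of_all _ hpos),
    ← integral_indicator measurableSet_closedBall]
  apply ENNReal.ofReal_le_ofReal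
  have e : (fun y : Eu (k + 2) => (closedBall (0 : Eu (k + 2)) s).indicator (fun y => g ‖y‖) y) =
      fun y => (Iic s).indicator g ‖y‖ := by
    ext y
    by_cases h : ‖y‖ ≤ s <;> simp [indicator, h]
  have e2 : ∫ r in Ioi (0 : ℝ), r ^ (k + 1) * (Iic s).indicator g r =
      ∫ r in (0 : ℝ)..s, r ^ (k + 1) * (2 / (r + δ)) ^ (k + 2) := by
    have : (fun r : ℝ => r ^ (k + 1) * (Iic s).indicator g r) =
        (Iic s).indicator (fun r => r ^ (k + 1) * g r) := by
      ext r
      by_cases h : r ≤ s <;> simp [indicator, h]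
    rw [this, setIntegral_indicator measurableSet_Iic, Ioi_inter_Iic,
      intervalIntegral.integral_of_le hs0.le]
  rw [e, integral_fun_norm_addHaar, finrank_euclideanSpace_fin]
  simp only [show k + 2 - 1 = k + 1 by omega, e2, nsmul_eq_mul, smul_eq_mul, measureReal_def]
  push_cast
  rw [mul_assoc]
  gcongr
  exact log_le_integral_radialDensity k hδ hs

theorem restrict_hausdorffMeasure_le_map {X Y : Type*} [EMetricSpace X] [MeasurableSpace X]
    [BorelSpace X] [EMetricSpace Y] [MeasurableSpace Y] [BorelSpace Y] {P : X → Y} {Φ : Y → X}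
    {B : Set Y} (hP : LipschitzWith 1 P) (hΦ : ∀ y ∈ B, P (Φ y) = y) {d : ℝ} (hd : 0 ≤ d) :
    (μH[d] : Measure Y).restrict B ≤ ((μH[d] : Measure X).restrict (Φ '' B)).map P := by
  have hPm : Measurable P := hP.continuous.measurable
  refine Measure.le_iff.2 fun t ht => ?_
  rw [Measure.restrict_apply ht, Measure.map_apply hPm ht, Measure.restrict_apply (hPm ht)]
  have hsub : t ∩ B ⊆ P '' (P ⁻¹' t ∩ Φ '' B) := fun y ⟨hyt, hyB⟩ =>
    ⟨Φ y, ⟨by rwa [mem_preimage, hΦ y hyB], y, hyB, rfl⟩, hΦ y hyB⟩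
  calc _ ≤ _ := measure_mono hsub
    _ ≤ _ := hP.hausdorffMeasure_image_le hd _
    _ = _ := by simp

theorem exists_linearIsometry_orthogonal (d : ℕ) {v : Eu (d + 1)} (hv : v ≠ 0) :
    ∃ J : Eu d →ₗᵢ[ℝ] Eu (d + 1), ∀ y, ⟪J y, v⟫ = 0 := by
  have : Fact (Module.finrank ℝ (Eu (d + 1)) = d + 1) := ⟨finrank_euclideanSpace_fin⟩
  let b := OrthonormalBasis.fromOrthogonalSpanSingleton (𝕜 := ℝ) d hv
  refine ⟨(Submodule.subtypeₗᵢ _).comp b.repr.symm.toLinearIsometry, fun y => ?_⟩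
  rw [real_inner_comm]
  exact Submodule.mem_orthogonal_singleton_iff_inner_right.1 (b.repr.symm y).2

theorem IsConvexBody.suppFn_le {n : ℕ} {K : Set (Eu n)} (hK : IsConvexBody K) {R : ℝ}
    (h0K : (0 : Eu n) ∈ K) (hdiam : diam K ≤ R) {v : Eu n} (hv : IsOuterNormal K 0 v)
    {w : Eu n} {t : ℝ} (ht : 0 ≤ t) : suppFn K (w + t • v) ≤ R * ‖w‖ := by
  refine csSup_le ⟨_, 0, h0K, rfl⟩ ?_
  rintro _ ⟨x, hx, rfl⟩
  have hxv : ⟪x, v⟫ ≤ 0 := by simpa using hv.2 x hx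
  have hxR : ‖x‖ ≤ R := by
    have := dist_le_diam_of_mem hK.2.1.isBounded hx h0K
    rw [dist_zero_right] at this
    exact this.trans hdiam
  have h1 : ⟪x, w⟫ ≤ R * ‖w‖ := (real_inner_le_norm x w).trans (by gcongr)
  simp only [inner_add_right, inner_smul_right]
  nlinarith [mul_nonneg ht (neg_nonneg.2 hxv)]

theorem IsConvexBody.inner_lt_suppFn {n : ℕ} {K : Set (Eu n)} (hK : IsConvexBody K)
    {ξ u : Eu n} (hξ : ξ ∈ interior K) (hu : u ≠ 0) : ⟪ξ, u⟫ < suppFn K u := by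
  obtain ⟨r, hr, hball⟩ := Metric.isOpen_iff.1 isOpen_interior ξ hξ
  have hun : 0 < ‖u‖ := norm_pos_iff.2 hu
  set c := r / (2 * ‖u‖) with hc
  have hc0 : 0 < c := by positivity
  have hmem : ξ + c • u ∈ K := by
    refine interior_subset (hball ?_)
    rw [mem_ball, dist_eq_norm, add_sub_cancel_left, norm_smul, Real.norm_of_nonneg hc0.le, hc]
    field_simp
    linarith
  have hbdd : BddAbove ((fun x => ⟪x, u⟫) '' K) :=
    (hK.2.1.image (by fun_prop)).bddAbove
  have := le_csSup hbdd ⟨_, hmem, rfl⟩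
  simp only [inner_add_left, inner_smul_left, real_inner_self_eq_norm_sq] at this
  have h2 : 0 < c * ‖u‖ ^ 2 := by positivity
  have h3 : (starRingEnd ℝ) c = c := rfl
  rw [h3] at this
  unfold suppFn
  linarith

/-- Decomposition of a unit vector near `v` into components orthogonal and parallel to `v`. -/
theorem exists_decomposition_of_mem_geodBall {n : ℕ} {v u : Eu n} {α : ℝ} (hv : ‖v‖ = 1)
    (hα : 0 ≤ α) (hα' : α ≤ Real.pi / 2) (hu : u ∈ geodBall v α) :
    ∃ (w : Eu n) (t : ℝ), 0 ≤ t ∧ u = w + t • v ∧ ‖w‖ ≤ Real.sin α := by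
  obtain ⟨hu1, hua⟩ := hu
  have hu1 : ‖u‖ = 1 := by simpa using hu1
  have hcos : ⟪u, v⟫ = Real.cos (InnerProductGeometry.angle u v) := by
    rw [InnerProductGeometry.cos_angle, hu1, hv]; simp
  have hle : Real.cos α ≤ ⟪u, v⟫ := by
    rw [hcos]
    exact Real.cos_le_cos_of_nonneg_of_le_pi (InnerProductGeometry.angle_nonneg _ _)
      (by linarith [Real.pi_pos]) hua
  have hc0 : 0 ≤ Real.cos α := Real.cos_nonneg_of_neg_pi_div_two_le_of_le (by linarith) hα'
  refine ⟨u - ⟪u, v⟫ • v, ⟪u, v⟫, hc0.trans hle, by simp, ?_⟩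
  have hs : 0 ≤ Real.sin α := Real.sin_nonneg_of_nonneg_of_le_pi hα (by linarith [Real.pi_pos])
  refine abs_le_of_sq_le_sq' ?_ hs |>.2
  have : ‖u - ⟪u, v⟫ • v‖ ^ 2 = 1 - ⟪u, v⟫ ^ 2 := by
    rw [norm_sub_sq_real, norm_smul, inner_smul_right, hu1, hv, Real.norm_eq_abs, mul_one, sq_abs]
    ring
  rw [this, Real.sin_sq]
  nlinarith

/-- A unit vector with orthogonal component of length at most `sin α` lies in `Ω(v, α)`. -/
theorem add_sqrt_smul_mem_geodBall {n : ℕ} {v w : Eu n} {α : ℝ} (hv : ‖v‖ = 1)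
    (hα : 0 ≤ α) (hα' : α ≤ Real.pi / 2) (hw : ⟪w, v⟫ = 0) (hwα : ‖w‖ ≤ Real.sin α) :
    w + √(1 - ‖w‖ ^ 2) • v ∈ geodBall v α := by
  have hsq : ‖w‖ ^ 2 ≤ Real.sin α ^ 2 := by gcongr
  have h1 : 0 ≤ 1 - ‖w‖ ^ 2 := by nlinarith [Real.sin_sq_le_one α]
  have hn : ‖w + √(1 - ‖w‖ ^ 2) • v‖ = 1 := by
    refine (sq_eq_sq₀ (norm_nonneg _) zero_le_one).1 ?_
    rw [norm_add_sq_real, inner_smul_right, hw, norm_smul, hv, mul_one, Real.norm_eq_abs, sq_abs,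
      Real.sq_sqrt h1]
    ring
  refine ⟨by simpa using hn, ?_⟩
  rw [InnerProductGeometry.angle, hn, hv, inner_add_left, hw, inner_smul_left,
    real_inner_self_eq_norm_sq, hv]
  have hc0 : 0 ≤ Real.cos α := Real.cos_nonneg_of_neg_pi_div_two_le_of_le (by linarith) hα'
  rw [← Real.arccos_cos hα (by linarith [Real.pi_pos])]
  apply Real.arccos_le_arccos
  have : Real.cos α ≤ √(1 - ‖w‖ ^ 2) :=
    Real.le_sqrt_of_sq_le (by rw [Real.cos_sq']; linarith)
  simpa using this

theorem rpow_lower_bound {R q r δ a : ℝ} {d : ℕ} (hR : 1 ≤ R) (hq : (d : ℝ) ≤ q) (hr : 0 ≤ r)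
    (hδ : 0 < δ) (hrδ : r + δ ≤ 2) (ha : 0 < a) (har : a ≤ R * (r + δ)) :
    (2 ^ q * R ^ q)⁻¹ * (2 / (r + δ)) ^ d ≤ a ^ (-q) := by
  have hq0 : 0 ≤ q := d.cast_nonneg.trans hq
  have hb : 0 < (r + δ) / 2 := by positivity
  have hR0 : 0 < R := by linarith
  calc (2 ^ q * R ^ q)⁻¹ * (2 / (r + δ)) ^ d
      = (2 * R) ^ (-q) * ((r + δ) / 2) ^ (-(d : ℝ)) := by
        rw [← Real.mul_rpow (by norm_num) hR0.le, ← Real.rpow_neg (by positivity),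
          Real.rpow_neg hb.le, Real.rpow_natCast, ← inv_pow, inv_div]
    _ ≤ (2 * R) ^ (-q) * ((r + δ) / 2) ^ (-q) := by
        refine mul_le_mul_of_nonneg_left ?_ (by positivity)
        exact Real.rpow_le_rpow_of_exponent_ge hb (by linarith) (by linarith)
    _ = (R * (r + δ)) ^ (-q) := by
        rw [← Real.mul_rpow (by positivity) hb.le]
        congr 1
        ring
    _ ≤ a ^ (-q) := Real.rpow_le_rpow_of_nonpos ha har (by linarith)

theorem IsConvexBody.lintegral_geodBall_ge {k : ℕ} {K : Set (Eu (k + 3))} (hK : IsConvexBody K)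
    {R q α δ : ℝ} (hR : 1 ≤ R) (hq : (k : ℝ) + 2 ≤ q) (h0K : (0 : Eu (k + 3)) ∈ K)
    (hdiam : diam K ≤ R) {v : Eu (k + 3)} (hv : IsOuterNormal K 0 v)
    (hα : 0 ≤ α) (hα' : α ≤ Real.pi / 2) (hδ : 0 < δ) (hδα : δ < Real.sin α)
    {ξ : Eu (k + 3)} (hξ : ξ ∈ interior K) (hξδ : ‖ξ‖ ≤ R * δ) :
    ENNReal.ofReal (((k + 1) * (volume (ball (0 : Eu (k + 1)) 1)).toReal / (2 ^ q * R ^ q)) *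
        Real.log (Real.sin α / δ)) ≤
      ∫⁻ u in geodBall v α, ENNReal.ofReal ((suppFn K u - ⟪ξ, u⟫) ^ (-q)) ∂(μH[(k + 2 : ℕ)]) := by
  have hv1 := hv.1
  have hv0 : v ≠ 0 := norm_ne_zero_iff.1 (by rw [hv1]; norm_num)
  have hR0 : 0 < R := by linarith
  have hs1 := Real.sin_le_one α
  obtain ⟨J, hJ⟩ := exists_linearIsometry_orthogonal (k + 2) hv0
  set P : Eu (k + 3) →L[ℝ] Eu (k + 2) :=
    ContinuousLinearMap.adjoint J.toContinuousLinearMap with hPdef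
  have hPJ : ∀ y, P (J y) = y := fun y => ext_inner_right ℝ fun z => by
    rw [hPdef, ContinuousLinearMap.adjoint_inner_left]
    exact J.inner_map_map y z
  have hPv : P v = 0 := ext_inner_right ℝ fun z => by
    rw [hPdef, ContinuousLinearMap.adjoint_inner_left, inner_zero_left, real_inner_comm]
    exact hJ z
  have hPlip : LipschitzWith 1 P := by
    refine P.lipschitz.weaken ?_
    rw [← NNReal.coe_le_coe, coe_nnnorm, hPdef, LinearIsometryEquiv.norm_map]
    exact J.norm_toContinuousLinearMap_le
  set Φ : Eu (k + 2) → Eu (k + 3) := fun y => J y + √(1 - ‖y‖ ^ 2) • v with hΦ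
  have hPΦ : ∀ y, P (Φ y) = y := fun y => by simp [hΦ, hPJ, hPv]
  set B : Set (Eu (k + 2)) := closedBall 0 (Real.sin α) with hB
  have hΦc : Continuous Φ := by
    have := J.continuous
    fun_prop
  have hΦB : MeasurableSet (Φ '' B) := ((isCompact_closedBall _ _).image hΦc).measurableSet
  have hΦmem : Φ '' B ⊆ geodBall v α := by
    rintro _ ⟨y, hy, rfl⟩
    have := add_sqrt_smul_mem_geodBall hv1 hα hα' (hJ y) (by
      rw [J.norm_map]; simpa [hB] using hy)
    rwa [J.norm_map] at this
  set g : Eu (k + 2) → ℝ := fun y => (2 / (‖y‖ + δ)) ^ (k + 2) with hg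
  set C : ℝ := (2 ^ q * R ^ q)⁻¹ with hC
  have hC0 : 0 ≤ C := by positivity
  have hgm : Measurable fun y => ENNReal.ofReal C * ENNReal.ofReal (g y) := by fun_prop
  have hpt : ∀ u ∈ Φ '' B, ENNReal.ofReal C * ENNReal.ofReal (g (P u)) ≤
      ENNReal.ofReal ((suppFn K u - ⟪ξ, u⟫) ^ (-q)) := by
    rintro _ ⟨y, hy, rfl⟩
    have hyα : ‖y‖ ≤ Real.sin α := by simpa [hB] using hy
    have hΦ1 : ‖Φ y‖ = 1 := by simpa using (hΦmem ⟨y, hy, rfl⟩).1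
    have hsup : suppFn K (Φ y) ≤ R * ‖y‖ := by
      simpa using hK.suppFn_le h0K hdiam hv (w := J y) (Real.sqrt_nonneg (1 - ‖y‖ ^ 2))
    have hpos := hK.inner_lt_suppFn hξ (norm_ne_zero_iff.1 (by rw [hΦ1]; norm_num))
    have hξu : -⟪ξ, Φ y⟫ ≤ R * δ := by
      have := (abs_real_inner_le_norm ξ (Φ y)).trans_eq (by rw [hΦ1, mul_one])
      linarith [neg_abs_le ⟪ξ, Φ y⟫]
    rw [hPΦ, ← ENNReal.ofReal_mul hC0]
    apply ENNReal.ofReal_le_ofReal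
    exact rpow_lower_bound hR (by push_cast; exact hq) (norm_nonneg y) hδ (by linarith)
      (sub_pos.2 hpos) (by linarith)
  obtain ⟨c, hc0, hc, hcvol⟩ := exists_smul_volume_le_hausdorffMeasure k
  have hlog : 0 ≤ Real.log (Real.sin α / δ) :=
    Real.log_nonneg (by rw [le_div_iff₀ hδ]; linarith)
  calc
    _ ≤ ENNReal.ofReal c * (ENNReal.ofReal C * ENNReal.ofReal ((k + 2) *
          (volume (ball (0 : Eu (k + 2)) 1)).toReal *
          (3 / 2 * Real.log (Real.sin α / δ)))) := by
      rw [← ENNReal.ofReal_mul hC0, ← ENNReal.ofReal_mul hc0]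
      apply ENNReal.ofReal_le_ofReal
      have h1 : ((k : ℝ) + 1) * (volume (ball (0 : Eu (k + 1)) 1)).toReal ≤
          (k + 2) * (3 / 2 * (c * (volume (ball (0 : Eu (k + 2)) 1)).toReal)) := by
        gcongr
        norm_num
      calc _ = ((k : ℝ) + 1) * (volume (ball (0 : Eu (k + 1)) 1)).toReal *
            (C * Real.log (Real.sin α / δ)) := by rw [hC]; ring
        _ ≤ (k + 2) * (3 / 2 * (c * (volume (ball (0 : Eu (k + 2)) 1)).toReal)) *
            (C * Real.log (Real.sin α / δ)) := by gcongr
        _ = _ := by ring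
    _ ≤ ENNReal.ofReal c * (ENNReal.ofReal C * ∫⁻ y in B, ENNReal.ofReal (g y)) := by
      gcongr
      exact log_le_lintegral_closedBall k hδ hδα
    _ = ∫⁻ y in B, ENNReal.ofReal C * ENNReal.ofReal (g y)
          ∂(ENNReal.ofReal c • (volume : Measure (Eu (k + 2)))) := by
      rw [Measure.restrict_smul, lintegral_smul_measure,
        lintegral_const_mul' _ _ ENNReal.ofReal_ne_top,
        smul_eq_mul]
    _ ≤ ∫⁻ y in B, ENNReal.ofReal C * ENNReal.ofReal (g y) ∂(μH[(k + 2 : ℕ)]) :=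
      lintegral_mono' (Measure.restrict_mono_measure hc _) le_rfl
    _ ≤ ∫⁻ y, ENNReal.ofReal C * ENNReal.ofReal (g y)
          ∂(((μH[(k + 2 : ℕ)] : Measure (Eu (k + 3))).restrict (Φ '' B)).map P) :=
      lintegral_mono' (restrict_hausdorffMeasure_le_map hPlip (fun y _ => hPΦ y)
        (Nat.cast_nonneg _)) le_rfl
    _ = ∫⁻ u in Φ '' B, ENNReal.ofReal C * ENNReal.ofReal (g (P u)) ∂(μH[(k + 2 : ℕ)]) :=
      lintegral_map hgm P.continuous.measurable
    _ ≤ ∫⁻ u in Φ '' B, ENNReal.ofReal ((suppFn K u - ⟪ξ, u⟫) ^ (-q)) ∂(μH[(k + 2 : ℕ)]) :=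
      setLIntegral_mono' hΦB hpt
    _ ≤ _ := lintegral_mono_set hΦmem

/-- Lemma 2.2: for `ε ∈ (0,1/3]`, `R ≥ 1`, `q ≥ n-1`, a convex body `K`
containing the origin on its boundary with `diam K ≤ R`, an exterior unit normal `v` at the
origin, and `α = arcsin (ε/(2R))`:
(i) if `ξ ∈ int K` with `‖ξ‖ < ε/2` and `u ∈ Ω(v,α)` then `h_K(u) - ⟨ξ,u⟩ < ε`;
(ii) if `δ ∈ (0, sin α)` and `ξ ∈ int K` with `‖ξ‖ ≤ Rδ` then
`∫_{Ω(v,α)} (h_K(u) - ⟨ξ,u⟩)^{-q} dH^{n-1} ≥ ((n-2)κ_{n-2}/(2^q R^q)) log (sin α / δ)`. -/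
theorem near_boundary_estimates
    (n : ℕ) (ε R q α : ℝ)
    (hε : ε ∈ Set.Ioc (0:ℝ) (1/3)) (hR : 1 ≤ R) (hq : (n : ℝ) - 1 ≤ q)
    (K : Set (Eu n)) (hK : IsConvexBody K) (h0K : (0 : Eu n) ∈ K)
    (h0bd : (0 : Eu n) ∈ frontier K) (hdiam : Metric.diam K ≤ R)
    (v : Eu n) (hv : IsOuterNormal K 0 v)
    (hα : α = Real.arcsin (ε / (2 * R))) :
    (∀ ξ ∈ interior K, ‖ξ‖ < ε / 2 →
        ∀ u ∈ geodBall v α, suppFn K u - ⟪ξ, u⟫ < ε) ∧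
    (∀ δ ∈ Set.Ioo (0:ℝ) (Real.sin α), ∀ ξ ∈ interior K, ‖ξ‖ ≤ R * δ →
        ENNReal.ofReal ((((n : ℝ) - 2) *
            (volume (closedBall (0 : Eu (n - 2)) 1)).toReal / (2 ^ q * R ^ q)) *
          Real.log (Real.sin α / δ)) ≤
        ∫⁻ u in geodBall v α, ENNReal.ofReal ((suppFn K u - ⟪ξ, u⟫) ^ (-q))
          ∂(μH[(n:ℝ) - 1])) := by
  obtain ⟨hε0, hε1⟩ := hε
  have hR0 : 0 < R := by linarith
  have hx0 : 0 < ε / (2 * R) := by positivity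
  have hx1 : ε / (2 * R) ≤ 1 := by rw [div_le_one (by positivity)]; linarith
  have hα0 : 0 ≤ α := hα ▸ Real.arcsin_nonneg.2 hx0.le
  have hα1 : α ≤ Real.pi / 2 := hα ▸ Real.arcsin_le_pi_div_two _
  have hsin : Real.sin α = ε / (2 * R) := by rw [hα, Real.sin_arcsin (by linarith) hx1]
  refine ⟨fun ξ _ hξε u hu => ?_, fun δ hδ ξ hξ hξδ => ?_⟩
  · have hu1 : ‖u‖ = 1 := by simpa using hu.1
    obtain ⟨w, t, ht, rfl, hw⟩ := exists_decomposition_of_mem_geodBall hv.1 hα0 hα1 hu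
    have h1 : suppFn K (w + t • v) ≤ ε / 2 := calc
      _ ≤ R * ‖w‖ := hK.suppFn_le h0K hdiam hv ht
      _ ≤ R * (ε / (2 * R)) := by rw [← hsin]; gcongr
      _ = ε / 2 := by field_simp
    have h2 := (abs_real_inner_le_norm ξ (w + t • v)).trans_eq (by rw [hu1, mul_one])
    linarith [neg_abs_le ⟪ξ, w + t • v⟫]
  · rcases Nat.lt_or_ge n 3 with hn | hn
    · have hn2 : (n : ℝ) - 2 ≤ 0 := by
        have : (n : ℝ) ≤ 2 := by exact_mod_cast (by omega : n ≤ 2)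
        linarith
      have hlog : 0 ≤ Real.log (Real.sin α / δ) :=
        Real.log_nonneg (by rw [le_div_iff₀ hδ.1]; linarith [hδ.2])
      rw [ENNReal.ofReal_of_nonpos]
      · exact zero_le
      · exact mul_nonpos_of_nonpos_of_nonneg (div_nonpos_of_nonpos_of_nonneg
          (mul_nonpos_of_nonpos_of_nonneg hn2 ENNReal.toReal_nonneg) (by positivity)) hlog
    · obtain ⟨k, rfl⟩ : ∃ k, n = k + 3 := ⟨n - 3, by omega⟩
      have e1 : ((k + 3 : ℕ) : ℝ) - 1 = (k + 2 : ℕ) := by push_cast; ring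
      have e2 : ((k + 3 : ℕ) : ℝ) - 2 = k + 1 := by push_cast; ring
      rw [e1] at hq ⊢
      rw [e2, show k + 3 - 2 = k + 1 by omega, Measure.addHaar_closedBall_eq_addHaar_ball]
      exact hK.lintegral_geodBall_ge hR (by push_cast at hq; exact hq) h0K hdiam hv hα0 hα1
        hδ.1 hδ.2 hξ hξδ

end
end
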